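/- arXiv:0811.1385 — 2 statements merged into one kernel-verified Lean document; each statement's English description precedes it below -/
import Mathlib

section
/- Let d be a square-free positive integer, O_d the ring of integers of the imaginary quadratic field ℚ(√−d), and Γ_d = PSL₂(O_d) the quotient of SL₂(O_d) by its center. If ḡ ∈ Γ_d has infinite order, then the centralizer C_{Γ_d}(ḡ) is virtually free abelian of rank at most 2, i.e., it contains a finite-index subgroup isomorphic to ℤⁿ for some n ≤ 2. -/
/-- The imaginary quadratic field `ℚ(√−d)`, realized inside `ℂ`
(note `√−d = i·√d`). -/
noncomputable def QsqrtNeg (d : ℕ) : IntermediateField ℚ ℂ :=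
  IntermediateField.adjoin ℚ {Complex.I * Real.sqrt d}

/-- The ring of integers `O_d` of `ℚ(√−d)`. -/
noncomputable def Od (d : ℕ) : Type :=
  NumberField.RingOfIntegers (QsqrtNeg d)

noncomputable instance (d : ℕ) : CommRing (Od d) :=
  inferInstanceAs (CommRing (NumberField.RingOfIntegers (QsqrtNeg d)))

/-- `SL₂(O_d)`. -/
noncomputable abbrev BianchiSL (d : ℕ) : Type :=
  Matrix.SpecialLinearGroup (Fin 2) (Od d)

/-- The Bianchi group `Γ_d = PSL₂(O_d)`, the quotient of `SL₂(O_d)` by its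
center. -/
noncomputable abbrev BianchiPSL (d : ℕ) : Type :=
  BianchiSL d ⧸ Subgroup.center (BianchiSL d)


lemma gen_sq (d : ℕ) : (Complex.I * (Real.sqrt d : ℂ))^2 = -(d:ℂ) := by
  rw [mul_pow, Complex.I_sq, ← Complex.ofReal_pow, Real.sq_sqrt (Nat.cast_nonneg d)]; simp

lemma gen_integral (d : ℕ) : IsIntegral ℚ (Complex.I * (Real.sqrt d : ℂ)) := by
  refine ⟨Polynomial.X^2 + Polynomial.C (d:ℚ), Polynomial.monic_X_pow_add_C _ (by norm_num), ?_⟩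
  simp only [Polynomial.eval₂_add, Polynomial.eval₂_pow, Polynomial.eval₂_X, Polynomial.eval₂_C]
  rw [gen_sq]; simp

lemma numField (d : ℕ) : NumberField (QsqrtNeg d) := by
  have : FiniteDimensional ℚ (QsqrtNeg d) := IntermediateField.adjoin.finiteDimensional (gen_integral d)
  exact { to_charZero := inferInstance, to_finiteDimensional := this }

lemma finrank_le (d : ℕ) : Module.finrank ℚ (QsqrtNeg d) ≤ 2 := by
  unfold QsqrtNeg
  rw [IntermediateField.adjoin.finrank (gen_integral d)]
  have hm : (Polynomial.X^2 + Polynomial.C (d:ℚ)).Monic := Polynomial.monic_X_pow_add_C _ (by norm_num)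
  have := minpoly.min ℚ (Complex.I * (Real.sqrt d : ℂ)) hm (by
    simp only [map_add, map_pow, Polynomial.aeval_X, Polynomial.aeval_C]
    rw [gen_sq]; simp)
  have h2 := Polynomial.natDegree_le_natDegree this
  rwa [Polynomial.natDegree_X_pow_add_C] at h2

lemma emb_norm (d : ℕ) (φ : QsqrtNeg d →+* ℂ) (x : QsqrtNeg d) : ‖φ x‖ = ‖(x:ℂ)‖ := by
  have hmem : Complex.I * (Real.sqrt d : ℂ) ∈ QsqrtNeg d :=
    IntermediateField.mem_adjoin_simple_self _ _
  have hs : (φ ⟨_, hmem⟩)^2 = (Complex.I * (Real.sqrt d : ℂ))^2 := by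
    rw [← map_pow]
    have : (⟨_, hmem⟩ : QsqrtNeg d)^2 = -(d : QsqrtNeg d) := by
      apply Subtype.ext
      push_cast
      exact gen_sq d
    rw [this, gen_sq]; simp
  have key : ∀ ψ : QsqrtNeg d →+* ℂ, φ ⟨_, hmem⟩ = ψ ⟨_, hmem⟩ → φ x = ψ x := by
    intro ψ h
    obtain ⟨x, hx⟩ := x
    induction hx using IntermediateField.adjoin_induction with
    | mem y hy => 
      obtain rfl := hy
      exact h
    | algebraMap q => 
      have : (⟨algebraMap ℚ ℂ q, (QsqrtNeg d).algebraMap_mem q⟩ : QsqrtNeg d) = (q : QsqrtNeg d) := by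
        apply Subtype.ext; simp
      exact (congrArg φ this).trans ((by simp : φ (q : QsqrtNeg d) = ψ q).trans (congrArg ψ this).symm)
    | add y z hy hz h1 h2 => 
      have := map_add φ ⟨y,hy⟩ ⟨z,hz⟩
      have h' := map_add ψ ⟨y,hy⟩ ⟨z,hz⟩
      exact this.trans ((congrArg₂ (·+·) h1 h2).trans h'.symm)
    | inv y hy h1 => 
      have := map_inv₀ φ ⟨y,hy⟩
      have h' := map_inv₀ ψ ⟨y,hy⟩
      exact this.trans ((congrArg (·⁻¹) h1).trans h'.symm)
    | mul y z hy hz h1 h2 => 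
      have := map_mul φ ⟨y,hy⟩ ⟨z,hz⟩
      have h' := map_mul ψ ⟨y,hy⟩ ⟨z,hz⟩
      exact this.trans ((congrArg₂ (·*·) h1 h2).trans h'.symm)
  rcases sq_eq_sq_iff_eq_or_eq_neg.mp hs with h | h
  · rw [key (algebraMap (QsqrtNeg d) ℂ) h]; rfl
  · rw [key ((starRingEnd ℂ).comp (algebraMap (QsqrtNeg d) ℂ)) (h.trans ?_)]
    · exact Complex.norm_conj _
    · change _ = (starRingEnd ℂ) (Complex.I * (Real.sqrt d : ℂ))
      simp

lemma Od_package (d : ℕ) : IsDomain (Od d) ∧ Module.Free ℤ (Od d) ∧ Module.Finite ℤ (Od d) ∧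
    Module.finrank ℤ (Od d) ≤ 2 ∧ ∃ ι : Od d →+* ℂ, Function.Injective ι ∧
      ∀ B : ℝ, {x : Od d | ‖ι x‖ ≤ B}.Finite := by
  have := numField d
  refine ⟨inferInstanceAs (IsDomain (NumberField.RingOfIntegers (QsqrtNeg d))),
    inferInstanceAs (Module.Free ℤ (NumberField.RingOfIntegers (QsqrtNeg d))),
    inferInstanceAs (Module.Finite ℤ (NumberField.RingOfIntegers (QsqrtNeg d))),
    (NumberField.RingOfIntegers.rank (QsqrtNeg d)).trans_le (finrank_le d),
    (algebraMap (QsqrtNeg d) ℂ).comp (algebraMap (NumberField.RingOfIntegers (QsqrtNeg d)) (QsqrtNeg d)), ?_, ?_⟩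
  · exact (algebraMap (QsqrtNeg d) ℂ).injective.comp (NumberField.RingOfIntegers.coe_injective)
  · intro B
    have h := NumberField.Embeddings.finite_of_norm_le (QsqrtNeg d) ℂ B
    refine Set.Finite.of_finite_image (f := fun x : Od d => algebraMap (NumberField.RingOfIntegers (QsqrtNeg d)) (QsqrtNeg d) x) (h.subset ?_) (NumberField.RingOfIntegers.coe_injective.injOn)
    rintro _ ⟨x, hx, rfl⟩
    refine ⟨NumberField.RingOfIntegers.isIntegral_coe x, fun φ => ?_⟩
    rw [emb_norm]
    exact hx

lemma vfree {D C F V : Type*} [CommGroup D] [Group C] [Finite F] [AddCommGroup V]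
    (π : D →* C) (c : C → F) (hc : ∀ h h', c h = c h' → h⁻¹ * h' ∈ π.range)
    (hπ : Finite π.ker) (f : Additive D →+ V) (hf : Finite f.ker)
    (h1 : Module.Free ℤ (LinearMap.range f.toIntLinearMap))
    (h2 : Module.Finite ℤ (LinearMap.range f.toIntLinearMap))
    (h3 : Module.finrank ℤ (LinearMap.range f.toIntLinearMap) ≤ 2) :
    ∃ n : ℕ, n ≤ 2 ∧ ∃ A : Subgroup C, A.FiniteIndex ∧
      Nonempty (A ≃* Multiplicative (Fin n → ℤ)) := by
  obtain ⟨s, hs⟩ := Module.projective_lifting_property f.toIntLinearMap.rangeRestrict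
    LinearMap.id f.toIntLinearMap.surjective_rangeRestrict
  let e := (Module.finBasis ℤ (LinearMap.range f.toIntLinearMap)).equivFun
  let S : Multiplicative (LinearMap.range f.toIntLinearMap) →* D :=
    AddMonoidHom.toMultiplicativeLeft s.toAddMonoidHom
  have hS : ∀ w, f.toIntLinearMap.rangeRestrict (Additive.ofMul (S (Multiplicative.ofAdd w))) = w :=
    fun w => LinearMap.congr_fun hs w
  let E : Multiplicative (Fin (Module.finrank ℤ (LinearMap.range f.toIntLinearMap)) → ℤ) ≃*
      Multiplicative (LinearMap.range f.toIntLinearMap) :=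
    AddEquiv.toMultiplicative e.symm.toAddEquiv
  have hinj : Function.Injective (π.comp S) := by
    rw [injective_iff_map_eq_one]
    intro w hw
    have hk : S w ∈ π.ker := hw
    have hfo : IsOfFinOrder (⟨S w, hk⟩ : π.ker) := isOfFinOrder_of_finite _
    obtain ⟨m, hm, hm'⟩ := isOfFinOrder_iff_pow_eq_one.mp hfo
    have h4 : S (w ^ m) = 1 := by
      rw [map_pow]; exact congrArg Subtype.val hm'
    have h5 := hS (w ^ m).toAdd
    rw [ofAdd_toAdd, h4, ofMul_one, map_zero, toAdd_pow] at h5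
    have h6 : (m : ℤ) • w.toAdd = 0 := by rw [natCast_zsmul]; exact h5.symm
    rcases smul_eq_zero.mp h6 with h | h
    · omega
    · exact h
  refine ⟨_, h3, (π.comp S).range, ?_, ⟨((MonoidHom.ofInjective hinj).symm.trans E.symm)⟩⟩
  have : Finite (C ⧸ (π.comp S).range) := by
    let r : F × f.ker → C ⧸ (π.comp S).range := fun p =>
      ((Function.invFun c p.1 * π (p.2 : Additive D).toMul : C) : C ⧸ (π.comp S).range)
    refine Finite.of_surjective r ?_
    intro q
    induction q using QuotientGroup.induction_on with
    | H h =>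
    have hr : c (Function.invFun c (c h)) = c h := Function.invFun_eq ⟨h, rfl⟩
    obtain ⟨x, hx⟩ := hc _ _ hr
    let w := f.toIntLinearMap.rangeRestrict (Additive.ofMul x)
    let y := S (Multiplicative.ofAdd w)
    have hy : Additive.ofMul (x * y⁻¹) ∈ f.ker := by
      have := congrArg Subtype.val (hS w)
      have h7 : f (Additive.ofMul y) = f (Additive.ofMul x) := this
      rw [AddMonoidHom.mem_ker, ofMul_mul, ofMul_inv, map_add, map_neg, h7, add_neg_cancel]
    refine ⟨(c h, ⟨_, hy⟩), ?_⟩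
    refine QuotientGroup.eq.mpr ⟨Multiplicative.ofAdd w, ?_⟩
    change π y = (Function.invFun c (c h) * π (x * y⁻¹))⁻¹ * h
    rw [map_mul, map_inv]
    have : h = Function.invFun c (c h) * π x := by rw [hx]; group
    rw [eq_inv_mul_iff_mul_eq]
    conv_rhs => rw [this]
    group
  exact Subgroup.finiteIndex_of_finite_quotient

open Matrix

lemma comm_lin (G H : Matrix (Fin 2) (Fin 2) ℂ) (hG : ¬ ∃ r : ℂ, G = r • 1)
    (h : H * G = G * H) : ∃ x y : ℂ, H = x • 1 + y • G := by
  have e := fun i j => congrFun (congrFun h i) j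
  have e00 := e 0 0
  have e01 := e 0 1
  have e10 := e 1 0
  simp only [Matrix.mul_apply, Fin.sum_univ_two] at e00 e01 e10
  by_cases hb : G 0 1 = 0
  · by_cases hc : G 1 0 = 0
    · by_cases ha : G 0 0 = G 1 1
      · exact absurd ⟨G 0 0, by ext i j; fin_cases i <;> fin_cases j <;> simp [hb, hc, ha]⟩ hG
      · have ha' := sub_ne_zero.mpr ha
        have h01 : H 0 1 = 0 := by
          have : H 0 1 * (G 0 0 - G 1 1) = 0 := by rw [hb] at e01; linear_combination -e01
          simpa [ha'] using this
        have h10 : H 1 0 = 0 := by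
          have : H 1 0 * (G 0 0 - G 1 1) = 0 := by rw [hc] at e10; linear_combination e10
          simpa [ha'] using this
        refine ⟨H 0 0 - (H 0 0 - H 1 1) / (G 0 0 - G 1 1) * G 0 0, (H 0 0 - H 1 1) / (G 0 0 - G 1 1), ?_⟩
        ext i j; fin_cases i <;> fin_cases j <;> simp [hb, hc, h01, h10]
        field_simp
        ring
    · refine ⟨H 0 0 - H 1 0 / G 1 0 * G 0 0, H 1 0 / G 1 0, ?_⟩
      ext i j; fin_cases i <;> fin_cases j <;> simp [hc]
      · field_simp; linear_combination e00
      · field_simp; linear_combination e10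
  · refine ⟨H 0 0 - H 0 1 / G 0 1 * G 0 0, H 0 1 / G 0 1, ?_⟩
    ext i j; fin_cases i <;> fin_cases j <;> simp [hb]
    · field_simp; linear_combination -e00
    · field_simp; linear_combination -e01

lemma vfree' {D C F V : Type*} [Group D] (hD : ∀ a b : D, a * b = b * a)
    [Group C] [Finite F] [AddCommGroup V]
    (π : D →* C) (c : C → F) (hc : ∀ h h', c h = c h' → h⁻¹ * h' ∈ π.range)
    (hπ : Finite π.ker) (f : D →* Multiplicative V) (hf : Finite f.ker)
    (W : Submodule ℤ V) (hW : ∀ v, v ∈ W ↔ ∃ x, f x = Multiplicative.ofAdd v)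
    (h1 : Module.Free ℤ W) (h2 : Module.Finite ℤ W) (h3 : Module.finrank ℤ W ≤ 2) :
    ∃ n : ℕ, n ≤ 2 ∧ ∃ A : Subgroup C, A.FiniteIndex ∧
      Nonempty (A ≃* Multiplicative (Fin n → ℤ)) := by
  let _ : CommGroup D := { (inferInstance : Group D) with mul_comm := hD }
  let f' : Additive D →+ V := MonoidHom.toAdditiveLeft f
  have : W = LinearMap.range f'.toIntLinearMap := by
    ext v
    rw [hW]
    exact Iff.rfl
  subst this
  exact vfree π c hc hπ f' hf h1 h2 h3

section
variable {O : Type} [CommRing O] (ι : O →+* ℂ) (hι : Function.Injective ι)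

/-- complex matrix of an element of SL2 -/
def rho (H : Matrix.SpecialLinearGroup (Fin 2) O) : Matrix (Fin 2) (Fin 2) ℂ := H.1.map ι

lemma rho_mul (H K : Matrix.SpecialLinearGroup (Fin 2) O) : rho ι (H * K) = rho ι H * rho ι K := by
  unfold rho
  exact Matrix.map_mul

lemma rho_det (H : Matrix.SpecialLinearGroup (Fin 2) O) :
    rho ι H 0 0 * rho ι H 1 1 - rho ι H 0 1 * rho ι H 1 0 = 1 := by
  have := congrArg ι H.2
  rw [Matrix.det_fin_two] at this
  simpa [rho] using this

include hι in
lemma rho_inj : Function.Injective (rho ι) := by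
  intro H K h
  ext i j
  exact hι (congrFun (congrFun h i) j)

include hι in
lemma rho_scalar (H : Matrix.SpecialLinearGroup (Fin 2) O) (r : ℂ) (h : rho ι H = r • 1) :
    H ∈ Subgroup.center (Matrix.SpecialLinearGroup (Fin 2) O) := by
  rw [Subgroup.mem_center_iff]
  intro K
  apply rho_inj ι hι
  rw [rho_mul, rho_mul, h]
  simp

include hι in
lemma center_fin : Finite (Subgroup.center (Matrix.SpecialLinearGroup (Fin 2) O)) := by
  have : IsDomain O := hι.isDomain ι
  exact Finite.of_equiv _ (Matrix.SpecialLinearGroup.center_equiv_rootsOfUnity' (n := Fin 2) (R := O) 0).symm.toEquiv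

include hι in
lemma coords (G : Matrix.SpecialLinearGroup (Fin 2) O)
    (hG : G ∉ Subgroup.center (Matrix.SpecialLinearGroup (Fin 2) O)) :
    ∃ X Y : Subgroup.centralizer ({G} : Set (Matrix.SpecialLinearGroup (Fin 2) O)) → ℂ,
      (∀ H, rho ι H.1 = X H • 1 + Y H • rho ι G) ∧
      (∀ H K, X (H * K) = X H * X K - Y H * Y K) ∧
      (∀ H K, Y (H * K) = X H * Y K + X K * Y H + (rho ι G 0 0 + rho ι G 1 1) * (Y H * Y K)) ∧
      (∀ H, X H ^ 2 + (rho ι G 0 0 + rho ι G 1 1) * X H * Y H + Y H ^ 2 = 1) := by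
  have hns : ¬ ∃ r : ℂ, rho ι G = r • 1 := fun ⟨r, hr⟩ => hG (rho_scalar ι hι G r hr)
  have hex : ∀ H : Subgroup.centralizer ({G} : Set (Matrix.SpecialLinearGroup (Fin 2) O)),
      ∃ x y : ℂ, rho ι H.1 = x • 1 + y • rho ι G := by
    intro H
    apply comm_lin _ _ hns
    rw [← rho_mul, ← rho_mul]
    rw [Subgroup.mem_centralizer_singleton_iff.mp H.2]
  choose X Y hXY using hex
  have huniq : ∀ x y x' y' : ℂ, x • 1 + y • rho ι G = x' • 1 + y' • rho ι G → x = x' ∧ y = y' := by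
    intro x y x' y' h
    have hy : y = y' := by
      by_contra hne
      have hne' := sub_ne_zero.mpr hne
      apply hns
      refine ⟨(y - y')⁻¹ * (x' - x), ?_⟩
      have : (y - y') • rho ι G = (x' - x) • (1 : Matrix (Fin 2) (Fin 2) ℂ) := by
        rw [sub_smul, sub_smul, sub_eq_sub_iff_add_eq_add, add_comm, h, add_comm]
      rw [mul_smul, ← this, smul_smul, inv_mul_cancel₀ hne', one_smul]
    subst hy
    refine ⟨?_, rfl⟩
    have := congrFun (congrFun h 0) 0
    simpa using this
  have hd := rho_det ι G
  have hmul : ∀ H K, X (H * K) = X H * X K - Y H * Y K ∧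
      Y (H * K) = X H * Y K + X K * Y H + (rho ι G 0 0 + rho ι G 1 1) * (Y H * Y K) := by
    intro H K
    apply huniq
    rw [← hXY]
    change rho ι (H.1 * K.1) = _
    rw [rho_mul, hXY, hXY]
    ext i j
    fin_cases i <;> fin_cases j <;> simp [Matrix.mul_apply, Fin.sum_univ_two]
    · linear_combination -(Y H * Y K) * hd
    · ring
    · ring
    · linear_combination -(Y H * Y K) * hd
  refine ⟨X, Y, hXY, fun H K => (hmul H K).1, fun H K => (hmul H K).2, ?_⟩
  intro H
  have h := rho_det ι H.1
  rw [hXY] at h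
  simp at h
  linear_combination h - Y H ^ 2 * hd

include hι in
lemma D_comm (G : Matrix.SpecialLinearGroup (Fin 2) O)
    (hG : G ∉ Subgroup.center (Matrix.SpecialLinearGroup (Fin 2) O))
    (H K : Subgroup.centralizer ({G} : Set (Matrix.SpecialLinearGroup (Fin 2) O))) :
    H * K = K * H := by
  obtain ⟨X, Y, h, hX, hY, -⟩ := coords ι hι G hG
  apply Subtype.ext
  apply rho_inj ι hι
  rw [h, h, hX, hX, hY, hY]
  congr 2 <;> ring

include hι in
lemma parabolic [Module.Free ℤ O] [Module.Finite ℤ O] (hr : Module.finrank ℤ O ≤ 2)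
    (G : Matrix.SpecialLinearGroup (Fin 2) O)
    (hG : G ∉ Subgroup.center (Matrix.SpecialLinearGroup (Fin 2) O))
    (ht : (rho ι G 0 0 + rho ι G 1 1) ^ 2 = 4) :
    ∃ (V : Type) (_ : AddCommGroup V)
      (f : Subgroup.centralizer ({G} : Set (Matrix.SpecialLinearGroup (Fin 2) O)) →* Multiplicative V)
      (W : Submodule ℤ V), Finite f.ker ∧ (∀ v, v ∈ W ↔ ∃ x, f x = Multiplicative.ofAdd v) ∧
      Module.Free ℤ W ∧ Module.Finite ℤ W ∧ Module.finrank ℤ W ≤ 2 := by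
  obtain ⟨X, Y, h, hX, hY, hdet⟩ := coords ι hι G hG
  have : IsDomain O := hι.isDomain ι
  have hij : ∃ i j : Fin 2, i ≠ j ∧ rho ι G i j ≠ 0 := by
    by_contra hcon
    push Not at hcon
    have h01 := hcon 0 1 (by decide)
    have h10 := hcon 1 0 (by decide)
    have hd := rho_det ι G
    rw [h01] at hd
    have : rho ι G 0 0 = rho ι G 1 1 := by
      have : (rho ι G 0 0 - rho ι G 1 1) ^ 2 = 0 := by linear_combination ht - 4 * hd
      exact sub_eq_zero.mp (pow_eq_zero_iff (by norm_num) |>.mp this)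
    exact hG (rho_scalar ι hι G (rho ι G 0 0) (by
      ext i j; fin_cases i <;> fin_cases j <;> simp [h01, h10, this]))
  obtain ⟨i, j, hne, hb⟩ := hij
  set t := rho ι G 0 0 + rho ι G 1 1 with htdef
  have hf : ∀ H : Subgroup.centralizer ({G} : Set (Matrix.SpecialLinearGroup (Fin 2) O)),
      ι ((H.1.1 0 0 + H.1.1 1 1) * H.1.1 i j) = (2 * X H + t * Y H) * (Y H * rho ι G i j) := by
    intro H
    rw [map_mul, map_add]
    change (rho ι H.1 0 0 + rho ι H.1 1 1) * rho ι H.1 i j = _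
    rw [h]
    simp only [Matrix.add_apply, Matrix.smul_apply, Matrix.one_apply_eq, Matrix.one_apply_ne hne, smul_eq_mul]
    rw [htdef]; ring
  have hsq : ∀ H, (2 * X H + t * Y H) ^ 2 = 4 := by
    intro H
    linear_combination 4 * hdet H + Y H ^ 2 * ht
  let f : Subgroup.centralizer ({G} : Set (Matrix.SpecialLinearGroup (Fin 2) O)) →* Multiplicative O :=
    MonoidHom.mk' (fun H => Multiplicative.ofAdd ((H.1.1 0 0 + H.1.1 1 1) * H.1.1 i j)) (by
      intro H K
      rw [← ofAdd_add]
      congr 1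
      apply hι
      rw [map_add, hf, hf, hf, hX, hY]
      have h1 := hsq H
      have h2 := hsq K
      have e1 : 2 * (X H * X K - Y H * Y K) + t * (X H * Y K + X K * Y H + t * (Y H * Y K))
        = (2 * X H + t * Y H) * (2 * X K + t * Y K) / 2 := by
        linear_combination (Y H * Y K / 2) * ht
      have e2 : X H * Y K + X K * Y H + t * (Y H * Y K) =
        ((2 * X H + t * Y H) * Y K + (2 * X K + t * Y K) * Y H) / 2 := by ring
      rw [e1, e2]
      linear_combination (rho ι G i j) * ((2 * X K + t * Y K) * Y K / 4 * h1 + (2 * X H + t * Y H) * Y H / 4 * h2))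
  have hker : ∀ H, f H = 1 → H.1 ∈ Subgroup.center (Matrix.SpecialLinearGroup (Fin 2) O) := by
    intro H hH
    have h0 : ι ((H.1.1 0 0 + H.1.1 1 1) * H.1.1 i j) = 0 := by
      have : (H.1.1 0 0 + H.1.1 1 1) * H.1.1 i j = 0 := hH
      rw [this, map_zero]
    rw [hf] at h0
    have hY0 : Y H = 0 := by
      rcases mul_eq_zero.mp h0 with h0 | h0
      · have := hsq H
        rw [h0] at this
        norm_num at this
      · simpa [hb] using h0
    apply rho_scalar ι hι _ (X H)
    rw [h, hY0]; simp
  refine ⟨O, inferInstance, f, AddSubgroup.toIntSubmodule (AddMonoidHom.range (MonoidHom.toAdditiveLeft f)), ?_, fun v => Iff.rfl,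
    inferInstance, inferInstance, (Submodule.finrank_le _).trans hr⟩
  · have := center_fin ι hι
    exact Finite.of_injective (fun H : f.ker => (⟨H.1.1, hker H.1 H.2⟩ :
      Subgroup.center (Matrix.SpecialLinearGroup (Fin 2) O))) (by
        intro H K hHK
        have h5 : H.1.1 = K.1.1 := congrArg
          (fun z : Subgroup.center (Matrix.SpecialLinearGroup (Fin 2) O) => z.1) hHK
        exact Subtype.ext (Subtype.ext h5))

lemma quad_fin (τ : ℂ) : {z : ℂ | z ^ 2 - τ * z + 1 = 0}.Finite := by
  by_cases h : ∃ z : ℂ, z ^ 2 - τ * z + 1 = 0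
  · obtain ⟨z, hz⟩ := h
    refine (Set.toFinite {z, τ - z}).subset ?_
    intro w hw
    have hw : w ^ 2 - τ * w + 1 = 0 := hw
    have : (w - z) * (w - (τ - z)) = 0 := by linear_combination hw - hz
    rcases mul_eq_zero.mp this with h | h
    · left; exact sub_eq_zero.mp h
    · right; exact sub_eq_zero.mp h
  · convert Set.finite_empty
    ext z
    simp only [Set.mem_ofPred_eq, Set.mem_empty_iff_false, iff_false]
    exact fun hz => h ⟨z, hz⟩

include hι in
lemma hyperbolic (hfin : ∀ B : ℝ, {x : O | ‖ι x‖ ≤ B}.Finite)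
    (G : Matrix.SpecialLinearGroup (Fin 2) O)
    (hG : G ∉ Subgroup.center (Matrix.SpecialLinearGroup (Fin 2) O))
    (ht : (rho ι G 0 0 + rho ι G 1 1) ^ 2 ≠ 4) :
    ∃ (V : Type) (_ : AddCommGroup V)
      (f : Subgroup.centralizer ({G} : Set (Matrix.SpecialLinearGroup (Fin 2) O)) →* Multiplicative V)
      (W : Submodule ℤ V), Finite f.ker ∧ (∀ v, v ∈ W ↔ ∃ x, f x = Multiplicative.ofAdd v) ∧
      Module.Free ℤ W ∧ Module.Finite ℤ W ∧ Module.finrank ℤ W ≤ 2 := by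
  obtain ⟨X, Y, h, hX, hY, hdet⟩ := coords ι hι G hG
  set t := rho ι G 0 0 + rho ι G 1 1 with htdef
  obtain ⟨s, hs⟩ := IsAlgClosed.exists_pow_nat_eq (t ^ 2 - 4) (n := 2) (by norm_num)
  have hs0 : s ≠ 0 := by
    rintro rfl
    exact ht (by linear_combination -hs)
  let χ : Subgroup.centralizer ({G} : Set (Matrix.SpecialLinearGroup (Fin 2) O)) → ℂ :=
    fun H => X H + Y H * ((t + s) / 2)
  let χ' : Subgroup.centralizer ({G} : Set (Matrix.SpecialLinearGroup (Fin 2) O)) → ℂ :=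
    fun H => X H + Y H * ((t - s) / 2)
  have hχ' : ∀ H, χ H * χ' H = 1 := by
    intro H
    simp only [χ, χ']
    linear_combination hdet H - Y H ^ 2 / 4 * hs
  have htr : ∀ H, ι (H.1.1 0 0 + H.1.1 1 1) = χ H + χ' H := by
    intro H
    rw [map_add]
    change rho ι H.1 0 0 + rho ι H.1 1 1 = _
    rw [h]
    simp [χ, χ', htdef]
    ring
  have hmul : ∀ H K, χ (H * K) = χ H * χ K := by
    intro H K
    simp only [χ, hX, hY]
    linear_combination -(Y H * Y K / 4) * hs
  have hne : ∀ H, χ H ≠ 0 := fun H h0 => by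
    have := hχ' H
    rw [h0, zero_mul] at this
    exact zero_ne_one this
  have hinj : Function.Injective χ := by
    intro H K hHK
    have h1 : χ' H = χ' K := by
      have e1 := hχ' H
      have e2 := hχ' K
      rw [hHK] at e1
      exact mul_left_cancel₀ (hne K) (e1.trans e2.symm)
    have hYY : Y H = Y K := by
      have : s * (Y H - Y K) = 0 := by
        simp only [χ, χ'] at hHK h1
        linear_combination hHK - h1
      exact sub_eq_zero.mp ((mul_eq_zero.mp this).resolve_left hs0)
    have hXX : X H = X K := by
      simp only [χ, hYY] at hHK
      exact add_right_cancel hHK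
    apply Subtype.ext
    apply rho_inj ι hι
    rw [h, h, hXX, hYY]
  let f : Subgroup.centralizer ({G} : Set (Matrix.SpecialLinearGroup (Fin 2) O)) →* Multiplicative ℝ :=
    MonoidHom.mk' (fun H => Multiplicative.ofAdd (Real.log ‖χ H‖)) (by
      intro H K
      rw [← ofAdd_add, hmul, norm_mul, Real.log_mul (norm_ne_zero_iff.mpr (hne H)) (norm_ne_zero_iff.mpr (hne K))])
  have hS : {H | |(f H).toAdd| ≤ 1}.Finite := by
    have hT := hfin (2 * Real.exp 1)
    have hU : (⋃ τ ∈ {x : O | ‖ι x‖ ≤ 2 * Real.exp 1}, {z : ℂ | z ^ 2 - ι τ * z + 1 = 0}).Finite :=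
      hT.biUnion (fun τ _ => quad_fin (ι τ))
    refine (hU.preimage hinj.injOn).subset ?_
    intro H hH
    have hH : |Real.log ‖χ H‖| ≤ 1 := hH
    rw [abs_le] at hH
    have hp : 0 < ‖χ H‖ := norm_pos_iff.mpr (hne H)
    have b1 : ‖χ H‖ ≤ Real.exp 1 := (Real.log_le_iff_le_exp hp).mp hH.2
    have b2 : ‖χ' H‖ ≤ Real.exp 1 := by
      have e : ‖χ H‖ * ‖χ' H‖ = 1 := by rw [← norm_mul, hχ', norm_one]
      have hp' : 0 < ‖χ' H‖ := by
        by_contra hc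
        have := le_antisymm (not_lt.mp hc) (norm_nonneg _)
        rw [this, mul_zero] at e
        exact zero_ne_one e
      apply (Real.log_le_iff_le_exp hp').mp
      have := congrArg Real.log e
      rw [Real.log_mul hp.ne' hp'.ne', Real.log_one] at this
      linarith
    refine Set.mem_biUnion (x := H.1.1 0 0 + H.1.1 1 1) ?_ ?_
    · change ‖ι _‖ ≤ _
      rw [htr]
      exact (norm_add_le _ _).trans (by linarith)
    · change χ H ^ 2 - ι _ * χ H + 1 = 0
      rw [htr]
      linear_combination -(hχ' H)
  let L : AddSubgroup ℝ := AddMonoidHom.range (MonoidHom.toAdditiveLeft f)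
  have hL : ∀ v, v ∈ L ↔ ∃ x, f x = Multiplicative.ofAdd v := fun v => Iff.rfl
  have hiso : ∃ a : ℝ, 0 < a ∧ Disjoint (L : Set ℝ) (Set.Ioo 0 a) := by
    have hfn : ((L : Set ℝ) ∩ Set.Ioo 0 1).Finite := by
      refine (hS.image (fun H => (f H).toAdd)).subset ?_
      rintro v ⟨hv, hv0, hv1⟩
      obtain ⟨x, hx⟩ := (hL v).mp hv
      refine ⟨x, ?_, congrArg Multiplicative.toAdd hx⟩
      change |(f x).toAdd| ≤ 1
      rw [hx, toAdd_ofAdd, abs_le]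
      constructor <;> linarith
    by_cases hemp : ((L : Set ℝ) ∩ Set.Ioo 0 1).Nonempty
    · obtain ⟨a, ha, hmin⟩ := Set.exists_min_image _ id hfn hemp
      refine ⟨a, ha.2.1, Set.disjoint_left.mpr ?_⟩
      intro v hv hv'
      have := hmin v ⟨hv, hv'.1, hv'.2.trans ha.2.2⟩
      exact absurd hv'.2 (not_lt.mpr this)
    · exact ⟨1, one_pos, Set.disjoint_iff_inter_eq_empty.mpr (Set.not_nonempty_iff_eq_empty.mp hemp)⟩
  obtain ⟨a, ha, hdis⟩ := hiso
  obtain ⟨b, hb⟩ := AddSubgroup.cyclic_of_isolated_zero ha hdis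
  have hfg : Module.Finite ℤ (Submodule.span ℤ {b}) := inferInstance
  refine ⟨ℝ, inferInstance, f, Submodule.span ℤ {b}, ?_, ?_, ?_, hfg, ?_⟩
  · refine (hS.subset ?_ : (f.ker : Set _).Finite).to_subtype
    intro H hH
    have : f H = 1 := hH
    change |(f H).toAdd| ≤ 1
    rw [this]; simp
  · intro v
    rw [← hL, hb, AddSubgroup.mem_closure_singleton, Submodule.mem_span_singleton]
  · infer_instance
  · have := finrank_span_le_card (R := ℤ) ({b} : Set ℝ)
    simp at this
    exact this.trans (by norm_num)

include hι in
lemma abstract_main [Module.Free ℤ O] [Module.Finite ℤ O] (hr : Module.finrank ℤ O ≤ 2)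
    (hfin : ∀ B : ℝ, {x : O | ‖ι x‖ ≤ B}.Finite)
    (g : Matrix.SpecialLinearGroup (Fin 2) O ⧸ Subgroup.center (Matrix.SpecialLinearGroup (Fin 2) O))
    (hg : g ≠ 1) :
    ∃ n : ℕ, n ≤ 2 ∧
      ∃ A : Subgroup (Subgroup.centralizer ({g} : Set (Matrix.SpecialLinearGroup (Fin 2) O ⧸
          Subgroup.center (Matrix.SpecialLinearGroup (Fin 2) O)))),
        A.FiniteIndex ∧ Nonempty (A ≃* Multiplicative (Fin n → ℤ)) := by
  obtain ⟨G, rfl⟩ := QuotientGroup.mk_surjective g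
  have hG : G ∉ Subgroup.center (Matrix.SpecialLinearGroup (Fin 2) O) := fun h =>
    hg ((QuotientGroup.eq_one_iff G).mpr h)
  have hcf := center_fin ι hι
  obtain ⟨V, _, f, W, hf, hW, h1, h2, h3⟩ : ∃ (V : Type) (_ : AddCommGroup V)
      (f : Subgroup.centralizer ({G} : Set (Matrix.SpecialLinearGroup (Fin 2) O)) →* Multiplicative V)
      (W : Submodule ℤ V), Finite f.ker ∧ (∀ v, v ∈ W ↔ ∃ x, f x = Multiplicative.ofAdd v) ∧
      Module.Free ℤ W ∧ Module.Finite ℤ W ∧ Module.finrank ℤ W ≤ 2 := by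
    by_cases ht : (rho ι G 0 0 + rho ι G 1 1) ^ 2 = 4
    · exact parabolic ι hι hr G hG ht
    · exact hyperbolic ι hι hfin G hG ht
  let Z := Subgroup.center (Matrix.SpecialLinearGroup (Fin 2) O)
  let C := Subgroup.centralizer ({(G : Matrix.SpecialLinearGroup (Fin 2) O ⧸ Z)} :
    Set (Matrix.SpecialLinearGroup (Fin 2) O ⧸ Z))
  let π : Subgroup.centralizer ({G} : Set (Matrix.SpecialLinearGroup (Fin 2) O)) →* C :=
    ((QuotientGroup.mk' Z).comp (Subgroup.subtype _)).codRestrict C (by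
      intro H
      rw [Subgroup.mem_centralizer_singleton_iff]
      exact congrArg (QuotientGroup.mk' Z) (Subgroup.mem_centralizer_singleton_iff.mp H.2))
  have hmem : ∀ h : C, (Quotient.out h.1 * G)⁻¹ * (G * Quotient.out h.1) ∈ Z := by
    intro h
    rw [← QuotientGroup.eq]
    have := Subgroup.mem_centralizer_singleton_iff.mp h.2
    rw [QuotientGroup.mk_mul, QuotientGroup.mk_mul, QuotientGroup.out_eq']
    exact this
  let c : C → Z := fun h => ⟨_, hmem h⟩
  refine vfree' (D_comm ι hι G hG) π c ?_ ?_ f hf W hW h1 h2 h3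
  · intro h k hhk
    obtain ⟨H, hH⟩ : ∃ H, H = Quotient.out h.1 := ⟨_, rfl⟩
    obtain ⟨K, hK⟩ : ∃ K, K = Quotient.out k.1 := ⟨_, rfl⟩
    have e : (Quotient.out h.1 * G)⁻¹ * (G * Quotient.out h.1) = (Quotient.out k.1 * G)⁻¹ * (G * Quotient.out k.1) :=
      congrArg Subtype.val hhk
    have hz := hmem h
    rw [← hH] at hz
    rw [← hH, ← hK] at e
    obtain ⟨z, hz'⟩ : ∃ z, z = (H * G)⁻¹ * (G * H) := ⟨_, rfl⟩
    rw [← hz'] at hz e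
    have hzc := Subgroup.mem_center_iff.mp hz
    have a1 : G * H = H * G * z := by rw [hz']; group
    have a2 : G * K = K * G * z := by rw [e]; group
    have hc : H⁻¹ * K ∈ Subgroup.centralizer ({G} : Set (Matrix.SpecialLinearGroup (Fin 2) O)) := by
      rw [Subgroup.mem_centralizer_singleton_iff]
      apply mul_right_cancel (b := z)
      calc H⁻¹ * K * G * z = H⁻¹ * (K * G * z) := by group
        _ = H⁻¹ * (G * H) * H⁻¹ * K := by rw [← a2]; group
        _ = G * (z * (H⁻¹ * K)) := by rw [a1]; group
        _ = G * (H⁻¹ * K) * z := by rw [← hzc]; group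
    refine ⟨⟨_, hc⟩, ?_⟩
    apply Subtype.ext
    change ((H⁻¹ * K : Matrix.SpecialLinearGroup (Fin 2) O) : Matrix.SpecialLinearGroup (Fin 2) O ⧸ Z) = h.1⁻¹ * k.1
    rw [QuotientGroup.mk_mul, QuotientGroup.mk_inv, hH, hK, QuotientGroup.out_eq', QuotientGroup.out_eq']
  · refine Finite.of_injective (fun H : π.ker => (⟨H.1.1, ?_⟩ : Z)) ?_
    · exact (QuotientGroup.eq_one_iff _).mp (congrArg Subtype.val (H.2 : π H.1 = 1))
    · intro H K hHK
      have h5 : H.1.1 = K.1.1 := congrArg (fun z : Z => z.1) hHK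
      exact Subtype.ext (Subtype.ext h5)
end

/-- For `d` a square-free positive integer and `ḡ ∈ Γ_d = PSL₂(O_d)`
of infinite order, the centralizer `C_{Γ_d}(ḡ)` is virtually free abelian of rank
at most `2`: it contains a finite-index subgroup isomorphic to `ℤⁿ` for some
`n ≤ 2`. -/
theorem centralizer_bianchi_virtually_free_abelian (d : ℕ) (hd : Squarefree d)
    (hdpos : 0 < d) (g : BianchiPSL d) (hg : ¬ IsOfFinOrder g) :
    ∃ n : ℕ, n ≤ 2 ∧
      ∃ A : Subgroup (Subgroup.centralizer ({g} : Set (BianchiPSL d))),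
        A.FiniteIndex ∧ Nonempty (A ≃* Multiplicative (Fin n → ℤ)) := by
  obtain ⟨_, _, _, hr, ι, hι, hfin⟩ := Od_package d
  refine abstract_main ι hι hr hfin g ?_
  rintro rfl
  exact hg IsOfFinOrder.one
end

section
/- The figure-eight knot group, presented as ⟨a, b, t ∣ t a t⁻¹ = a b a, t b t⁻¹ = b a⟩ (equivalently, the semidirect product F₂ ⋊_φ ℤ, the mapping torus of the automorphism φ of the free group F(a,b) with φ(a) = aba and φ(b) = ba), is conjugacy separable. -/
/-- A group is conjugacy separable if non-conjugate elements stay non-conjugate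
in some finite quotient. -/
def ConjSeparable (G : Type) [Group G] : Prop :=
  ∀ x y : G, ¬ IsConj x y →
    ∃ (Q : Type) (_ : Group Q) (_ : Finite Q) (φ : G →* Q), ¬ IsConj (φ x) (φ y)

/-- The figure-eight knot group
`⟨a, b, t ∣ t a t⁻¹ = a b a, t b t⁻¹ = b a⟩`
(generators: `0 ↦ a`, `1 ↦ b`, `2 ↦ t`), i.e. the mapping torus of the
automorphism `φ` of the free group `F(a,b)` with `φ(a) = aba`, `φ(b) = ba`. -/
abbrev FigureEightKnotGroup : Type :=
  PresentedGroup
    ({FreeGroup.of (2 : Fin 3) * FreeGroup.of (0 : Fin 3) *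
        (FreeGroup.of (2 : Fin 3))⁻¹ *
        (FreeGroup.of (0 : Fin 3) * FreeGroup.of (1 : Fin 3) *
          FreeGroup.of (0 : Fin 3))⁻¹,
      FreeGroup.of (2 : Fin 3) * FreeGroup.of (1 : Fin 3) *
        (FreeGroup.of (2 : Fin 3))⁻¹ *
        (FreeGroup.of (1 : Fin 3) * FreeGroup.of (0 : Fin 3))⁻¹} :
        Set (FreeGroup (Fin 3)))

namespace FigEight

section Synt
variable {L : Type}
open scoped Classical

abbrev SA (L : Type) := MonoidAlgebra (ZMod 2) (FreeMonoid L)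

/-- sum of coefficients over a finite set of words -/
noncomputable def tauA (S : Finset (FreeMonoid L)) : SA L →+ ZMod 2 where
  toFun a := ∑ w ∈ S, a.coeff w
  map_zero' := by simp
  map_add' a b := by simp [Finset.sum_add_distrib]

lemma tauA_single (S : Finset (FreeMonoid L)) (w : FreeMonoid L) (r : ZMod 2) :
    tauA S (MonoidAlgebra.single w r) = if w ∈ S then r else 0 := by
  simp [tauA, Finsupp.single_apply]

def syntCon (S : Finset (FreeMonoid L)) : RingCon (SA L) where
  r a b := ∀ p q, tauA S (p * a * q) = tauA S (p * b * q)
  iseqv := ⟨fun _ _ _ => rfl, fun h p q => (h p q).symm, fun h h' p q => (h p q).trans (h' p q)⟩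
  mul' := by
    intro a b c d h h' p q
    have h1 := h p (c * q)
    have h2 := h' (p * b) q
    simp only [mul_assoc] at *
    rw [h1, h2]
  add' := by
    intro a b c d h h' p q
    simp only [mul_add, add_mul, map_add, h p q, h' p q]

lemma sa_induction {P : SA L → Prop} (a : SA L) (h0 : P 0) (hadd : ∀ a b, P a → P b → P (a + b))
    (hs : ∀ w : FreeMonoid L, P (MonoidAlgebra.single w 1)) : P a := by
  induction a using MonoidAlgebra.induction_linear with
  | zero => exact h0
  | add f g hf hg => exact hadd _ _ hf hg
  | single w r =>
    have : r = 0 ∨ r = 1 := by revert r; decide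
    rcases this with rfl | rfl
    · simpa using h0
    · exact hs w

lemma sa_two (a : SA L) : a + a = 0 := by
  have : (2 : ZMod 2) = 0 := rfl
  rw [← two_smul (ZMod 2) a, this, zero_smul]

lemma tauA_comm (S : Finset (FreeMonoid L)) (hrot : ∀ w w', w * w' ∈ S → w' * w ∈ S) (a b : SA L) :
    tauA S (a * b) = tauA S (b * a) := by
  induction a using sa_induction with
  | h0 => simp
  | hadd a a' h h' => simp [add_mul, mul_add, h, h']
  | hs w =>
    induction b using sa_induction with
    | h0 => simp
    | hadd a a' h h' => simp [add_mul, mul_add, h, h']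
    | hs w' =>
      rw [MonoidAlgebra.single_mul_single, MonoidAlgebra.single_mul_single, tauA_single, tauA_single]
      have : w * w' ∈ S ↔ w' * w ∈ S := ⟨hrot _ _, hrot _ _⟩
      simp [this]

lemma syntCon_of_single (S : Finset (FreeMonoid L)) (a b : SA L)
    (h : ∀ w w' : FreeMonoid L, tauA S (MonoidAlgebra.single w 1 * a * MonoidAlgebra.single w' 1) =
      tauA S (MonoidAlgebra.single w 1 * b * MonoidAlgebra.single w' 1)) : syntCon S a b := by
  intro p q
  induction p using sa_induction with
  | h0 => simp
  | hadd a a' h h' => simp [add_mul, h, h']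
  | hs w =>
    induction q using sa_induction with
    | h0 => simp
    | hadd a a' h h' => simp [mul_add, h, h']
    | hs w' => exact h w w'

lemma tau_long (S : Finset (FreeMonoid L)) (n : ℕ) (hS : ∀ w ∈ S, w.length = n)
    (w w' : FreeMonoid L) (h : n < w.length ∨ n < w'.length) (a : SA L) :
    tauA S (MonoidAlgebra.single w 1 * a * MonoidAlgebra.single w' 1) = 0 := by
  induction a using sa_induction with
  | h0 => simp
  | hadd a a' h h' => simp [mul_add, add_mul, h, h']
  | hs v =>
    rw [MonoidAlgebra.single_mul_single, MonoidAlgebra.single_mul_single, tauA_single, if_neg]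
    intro hm
    have := hS _ hm
    simp only [FreeMonoid.length_mul] at this
    omega

lemma synt_finite [Finite L] (S : Finset (FreeMonoid L)) (n : ℕ) (hS : ∀ w ∈ S, w.length = n) :
    Finite (syntCon S).Quotient := by
  have hfin : Finite {w : FreeMonoid L // w.length ≤ n} := by
    have := List.finite_length_le L n
    exact this.to_subtype
  let B := {w : FreeMonoid L // w.length ≤ n}
  let F : (syntCon S).Quotient → (B × B → ZMod 2) :=
    Quotient.lift (s := (syntCon S).toSetoid) (fun a ww => tauA S (MonoidAlgebra.single ww.1.1 1 * a * MonoidAlgebra.single ww.2.1 1))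
      (by
        intro a b h
        funext ww
        exact h _ _)
  apply Finite.of_injective F
  intro a b
  induction a using Quotient.inductionOn with | _ a => ?_
  induction b using Quotient.inductionOn with | _ b => ?_
  intro h
  apply Quotient.sound
  apply syntCon_of_single
  intro w w'
  by_cases hw : w.length ≤ n
  · by_cases hw' : w'.length ≤ n
    · exact congrFun h (⟨w, hw⟩, ⟨w', hw'⟩)
    · rw [tau_long S n hS, tau_long S n hS] <;> omega
  · rw [tau_long S n hS, tau_long S n hS] <;> omega

lemma coeff_prod (e : List L) : ∀ w : FreeMonoid L, e.length ≤ w.length →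
    ((e.map fun x => (1 + MonoidAlgebra.single (FreeMonoid.of x) 1 : SA L)).prod).coeff w
      = if w = FreeMonoid.ofList e then 1 else 0 := by
  induction e with
  | nil =>
    intro w _
    simp [MonoidAlgebra.one_def, Finsupp.single_apply, eq_comm]
  | cons x e ih =>
    intro w hw
    cases w using FreeMonoid.casesOn with
    | one => simp at hw
    | of_mul y w =>
      simp only [List.map_cons, List.prod_cons, add_mul, one_mul, MonoidAlgebra.coeff_add, Finsupp.add_apply]
      simp only [List.length_cons, FreeMonoid.length_mul, FreeMonoid.length_of] at hw
      rw [ih _ (by simp only [FreeMonoid.length_mul, FreeMonoid.length_of]; omega)]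
      have hne : FreeMonoid.of y * w ≠ FreeMonoid.ofList e := by
        intro h
        have := congrArg FreeMonoid.length h
        simp only [FreeMonoid.length_mul, FreeMonoid.length_of] at this
        have h2 : (FreeMonoid.ofList e).length = e.length := rfl
        omega
      rw [if_neg hne, zero_add]
      by_cases hxy : x = y
      · subst hxy
        rw [MonoidAlgebra.coeff_single_mul_eq_mul_coeff w (by simp), one_mul, ih w (by omega)]
        simp [FreeMonoid.ofList_cons]
      · rw [MonoidAlgebra.coeff_single_mul_of_forall_mul_ne, if_neg]
        · intro h
          have := congrArg FreeMonoid.toList h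
          simp at this
          exact hxy this.1.symm
        · intro d h
          have := congrArg FreeMonoid.toList h
          simp at this
          exact hxy this.1

lemma word_mem (S : Finset (List L)) (S' : Finset (FreeMonoid L)) (h : S' = S)
    (w w' : FreeMonoid L) (E E' : L) :
    w * (FreeMonoid.of E * FreeMonoid.of E') * w' ∈ S' ↔
      w.toList ++ E :: E' :: w'.toList ∈ S := by
  subst h
  have : w * (FreeMonoid.of E * FreeMonoid.of E') * w' =
      FreeMonoid.ofList (w.toList ++ E :: E' :: w'.toList) := by
    apply FreeMonoid.toList.injective
    simp
  rw [this]
  rfl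

theorem synt_exists [Finite L] (S : Finset (List L)) (n : ℕ) (hS : ∀ w ∈ S, w.length = n)
    (hrot : ∀ w w', w ++ w' ∈ S → w' ++ w ∈ S) :
    ∃ (R : Type) (_ : Ring R) (_ : Finite R) (z : L → R) (τ : R →+ ZMod 2),
      (∀ a b, τ (a * b) = τ (b * a)) ∧ (∀ a : R, a + a = 0) ∧
      (∀ E E', (∀ w w', w ++ E :: E' :: w' ∉ S) → z E * z E' = 0) ∧
      (∀ E E', (∀ w w', w ++ E :: E' :: w' ∈ S ↔ w ++ E' :: E :: w' ∈ S) →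
        z E * z E' = z E' * z E) ∧
      (∀ e : List L, e.length ≤ n →
        (e ∈ S → τ ((e.map fun x => 1 + z x).prod) = 1) ∧
        (e ∉ S → τ ((e.map fun x => 1 + z x).prod) = 0)) := by
  let S' : Finset (FreeMonoid L) := S
  let c := syntCon S'
  let τ : c.Quotient →+ ZMod 2 :=
    { toFun := Quotient.lift (s := c.toSetoid) (fun a => tauA S' a) (by
        intro a b h
        simpa using h 1 1)
      map_zero' := by
        change tauA S' 0 = 0
        simp
      map_add' := by
        intro a b
        induction a using Quotient.inductionOn with | _ a => ?_
        induction b using Quotient.inductionOn with | _ b => ?_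
        exact map_add (tauA S') a b }
  let z : L → c.Quotient := fun x => c.mk' (MonoidAlgebra.single (FreeMonoid.of x) 1)
  refine ⟨c.Quotient, inferInstance, synt_finite S' n hS, z, τ, ?_, ?_, ?_, ?_, ?_⟩
  · intro a b
    induction a using Quotient.inductionOn with | _ a => ?_
    induction b using Quotient.inductionOn with | _ b => ?_
    exact tauA_comm S' hrot a b
  · intro a
    induction a using Quotient.inductionOn with | _ a => ?_
    exact congrArg c.mk' (sa_two a)
  · intro E E' h
    have : c (MonoidAlgebra.single (FreeMonoid.of E) 1 * MonoidAlgebra.single (FreeMonoid.of E') 1) 0 := by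
      apply syntCon_of_single
      intro w w'
      simp only [MonoidAlgebra.single_mul_single, tauA_single, mul_zero, zero_mul, map_zero]
      rw [if_neg]
      intro hm
      exact h w.toList w'.toList ((word_mem S S' rfl w w' E E').1 hm)
    exact (c.eq).2 this
  · intro E E' h
    have : c (MonoidAlgebra.single (FreeMonoid.of E) 1 * MonoidAlgebra.single (FreeMonoid.of E') 1)
      (MonoidAlgebra.single (FreeMonoid.of E') 1 * MonoidAlgebra.single (FreeMonoid.of E) 1) := by
      apply syntCon_of_single
      intro w w'
      simp only [MonoidAlgebra.single_mul_single, tauA_single]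
      exact if_congr (((word_mem S S' rfl w w' E E').trans (h w.toList w'.toList)).trans
        (word_mem S S' rfl w w' E' E).symm) rfl rfl
    exact (c.eq).2 this
  · intro e he
    have h1 : (e.map fun x => 1 + z x).prod =
        c.mk' ((e.map fun x => (1 + MonoidAlgebra.single (FreeMonoid.of x) 1 : SA L)).prod) := by
      rw [map_list_prod, List.map_map]
      congr 1
    rw [h1]
    suffices hh : tauA S' ((e.map fun x => (1 + MonoidAlgebra.single (FreeMonoid.of x) 1 : SA L)).prod) =
        if FreeMonoid.ofList e ∈ S' then 1 else 0 from
      ⟨fun h => hh.trans (if_pos h), fun h => hh.trans (if_neg h)⟩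
    have : ∀ w ∈ S', ((e.map fun x => (1 + MonoidAlgebra.single (FreeMonoid.of x) 1 : SA L)).prod).coeff w
      = if w = FreeMonoid.ofList e then 1 else 0 := by
      intro w hw
      apply coeff_prod
      exact he.trans (hS w hw).ge
    change ∑ w ∈ S', _ = _
    rw [Finset.sum_congr rfl this, Finset.sum_ite_eq']

end Synt
end FigEight

namespace FigEight

/-- monomial (wreath type) group -/
@[ext] structure Mono (S K : Type) where
  perm : Equiv.Perm S
  lab : S → K

namespace Mono
variable {S K : Type} [Group K]

instance : Mul (Mono S K) := ⟨fun a b => ⟨a.perm * b.perm, fun s => a.lab (b.perm s) * b.lab s⟩⟩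
instance : One (Mono S K) := ⟨⟨1, fun _ => 1⟩⟩
instance : Inv (Mono S K) := ⟨fun a => ⟨a.perm⁻¹, fun s => (a.lab (a.perm⁻¹ s))⁻¹⟩⟩

@[simp] lemma mul_perm (a b : Mono S K) : (a * b).perm = a.perm * b.perm := rfl
@[simp] lemma mul_lab (a b : Mono S K) (s : S) : (a * b).lab s = a.lab (b.perm s) * b.lab s := rfl
@[simp] lemma one_perm : (1 : Mono S K).perm = 1 := rfl
@[simp] lemma one_lab (s : S) : (1 : Mono S K).lab s = 1 := rfl
@[simp] lemma inv_perm (a : Mono S K) : (a⁻¹).perm = a.perm⁻¹ := rfl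
@[simp] lemma inv_lab (a : Mono S K) (s : S) : (a⁻¹).lab s = (a.lab (a.perm⁻¹ s))⁻¹ := rfl

instance : Group (Mono S K) := Group.ofLeftAxioms
  (by intro a b c; ext s <;> simp [mul_assoc])
  (by intro a; ext s <;> simp)
  (by intro a; ext s <;> simp)

/-- the permutation homomorphism -/
def permHom (S K : Type) [Group K] : Mono S K →* Equiv.Perm S where
  toFun a := a.perm
  map_one' := rfl
  map_mul' _ _ := rfl

/-- the label homomorphism on a point stabiliser -/
def stabHom {G : Type} [Group G] (Φ : G →* Mono S K) (s0 : S) (H : Subgroup G)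
    (hH : ∀ h ∈ H, (Φ h).perm s0 = s0) : H →* K where
  toFun h := (Φ h).lab s0
  map_one' := by simp
  map_mul' a b := by simp [hH b b.2]

end Mono

section RACG
variable {X : Type} (adj : X → X → Prop)

def racgRels : Set (FreeGroup X) :=
  {r | (∃ x, r = FreeGroup.of x * FreeGroup.of x) ∨
    ∃ x y, adj x y ∧ r = FreeGroup.of x * FreeGroup.of y * (FreeGroup.of x)⁻¹ * (FreeGroup.of y)⁻¹}

abbrev RACG := PresentedGroup (racgRels adj)

variable {adj}

def rg (x : X) : RACG adj := PresentedGroup.of x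

lemma rg_sq (x : X) : (rg x : RACG adj) * rg x = 1 :=
  PresentedGroup.one_of_mem (rels := racgRels adj) (Or.inl ⟨x, rfl⟩)

lemma rg_inv (x : X) : (rg x : RACG adj)⁻¹ = rg x := inv_eq_of_mul_eq_one_left (rg_sq x)

lemma rg_comm {x y : X} (h : adj x y) : (rg x : RACG adj) * rg y = rg y * rg x := by
  have := PresentedGroup.one_of_mem (rels := racgRels adj) (Or.inr ⟨x, y, h, rfl⟩)
  have h2 : (rg x : RACG adj) * rg y * (rg x)⁻¹ * (rg y)⁻¹ = 1 := this
  rw [mul_inv_eq_one, mul_inv_eq_iff_eq_mul] at h2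
  exact h2

def racgLift {K : Type} [Group K] (f : X → K) (h1 : ∀ x, f x * f x = 1)
    (h2 : ∀ x y, adj x y → f x * f y = f y * f x) : RACG adj →* K :=
  PresentedGroup.toGroup (f := f) (by
    rintro r (⟨x, rfl⟩ | ⟨x, y, h, rfl⟩)
    · simp [h1]
    · simp [h2 x y h])

lemma racgLift_rg {K : Type} [Group K] (f : X → K) (h1 : ∀ x, f x * f x = 1)
    (h2 : ∀ x y, adj x y → f x * f y = f y * f x) (x : X) :
    racgLift (adj := adj) f h1 h2 (rg x) = f x := PresentedGroup.toGroup.of _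

lemma racg_hom_ext {K : Type} [Group K] {f g : RACG adj →* K} (h : ∀ x, f (rg x) = g (rg x)) : f = g :=
  PresentedGroup.ext h

def wprod (l : List X) : RACG adj := (l.map rg).prod

@[simp] lemma wprod_nil : (wprod [] : RACG adj) = 1 := rfl
@[simp] lemma wprod_cons (x : X) (l : List X) : (wprod (x :: l) : RACG adj) = rg x * wprod l := by
  simp [wprod]
@[simp] lemma wprod_append (l l' : List X) :
    (wprod (l ++ l') : RACG adj) = wprod l * wprod l' := by simp [wprod]

lemma exists_word (w : RACG adj) : ∃ l, wprod l = w := by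
  let H : Subgroup (RACG adj) :=
    { carrier := {w | ∃ l, wprod l = w}
      one_mem' := ⟨[], rfl⟩
      mul_mem' := by
        rintro _ _ ⟨l, rfl⟩ ⟨l', rfl⟩
        exact ⟨l ++ l', by simp⟩
      inv_mem' := by
        rintro _ ⟨l, rfl⟩
        refine ⟨l.reverse, ?_⟩
        induction l with
        | nil => simp
        | cons x l ih => simp [ih, rg_inv] }
  exact PresentedGroup.generated_by _ H (fun x => ⟨[x], by simp [rg]⟩) w

open scoped Classical in
/-- retraction onto the special subgroup -/
noncomputable def rho (S : Set X) : RACG adj →* RACG adj :=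
  racgLift (fun x => if x ∈ S then rg x else 1)
    (by intro x; split_ifs <;> simp [rg_sq])
    (by intro x y h; split_ifs <;> simp [rg_comm h])

lemma rho_mem {S : Set X} {x : X} (h : x ∈ S) : rho S (rg x : RACG adj) = rg x := by
  rw [rho, racgLift_rg, if_pos h]

lemma rho_not {S : Set X} {x : X} (h : x ∉ S) : rho S (rg x : RACG adj) = 1 := by
  rw [rho, racgLift_rg, if_neg h]

lemma rho_rho (S T : Set X) (w : RACG adj) : rho S (rho T w) = rho (S ∩ T) w := by
  have : (rho S).comp (rho T) = rho (adj := adj) (S ∩ T) := by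
    apply racg_hom_ext
    intro x
    by_cases hT : x ∈ T <;> by_cases hS : x ∈ S <;>
      simp [rho_mem, rho_not, hT, hS]
  exact DFunLike.congr_fun this w

lemma rho_univ (w : RACG adj) : rho Set.univ w = w := by
  have : rho (adj := adj) Set.univ = MonoidHom.id _ := by
    apply racg_hom_ext
    intro x
    simp [rho_mem]
  exact DFunLike.congr_fun this w

def St (adj : X → X → Prop) (x : X) : Set X := {y | y = x ∨ adj x y}

lemma rho_commute {S : Set X} {x : X} (h : S ⊆ St adj x) (w : RACG adj) :
    Commute (rho S w) (rg x) := by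
  let H : Subgroup (RACG adj) := (Subgroup.centralizer {rg x}).comap (rho S)
  have : w ∈ H := by
    apply PresentedGroup.generated_by
    intro y
    change rho S (rg y) ∈ Subgroup.centralizer {rg x}
    rw [Subgroup.mem_centralizer_singleton_iff]
    by_cases hy : y ∈ S
    · rw [rho_mem hy]
      rcases h hy with rfl | h
      · rfl
      · first | exact (rg_comm h) | exact (rg_comm h).symm
    · rw [rho_not hy]; simp
  have h2 := Subgroup.mem_centralizer_singleton_iff.1 (Subgroup.mem_comap.1 this)
  exact h2

/-- the finite index normal subgroup stable under retractions -/
noncomputable def stabSub (H0 : Subgroup (RACG adj)) : Subgroup (RACG adj) :=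
  ⨅ S : Set X, H0.comap (rho S)

lemma stabSub_le (H0 : Subgroup (RACG adj)) : stabSub H0 ≤ H0 := by
  intro w hw
  have := (Subgroup.mem_iInf.1 hw) Set.univ
  rwa [Subgroup.mem_comap, rho_univ] at this

lemma stabSub_rho (H0 : Subgroup (RACG adj)) (S : Set X) {w : RACG adj} (hw : w ∈ stabSub H0) :
    rho S w ∈ stabSub H0 := by
  refine Subgroup.mem_iInf.2 fun T => ?_
  rw [Subgroup.mem_comap, rho_rho]
  exact (Subgroup.mem_iInf.1 hw) _

instance stabSub_normal (H0 : Subgroup (RACG adj)) [H0.Normal] : (stabSub H0).Normal :=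
  Subgroup.normal_iInf_normal fun _ => inferInstance

lemma stabSub_finiteIndex [Finite X] (H0 : Subgroup (RACG adj)) [H0.FiniteIndex] :
    (stabSub H0).FiniteIndex :=
  Subgroup.finiteIndex_iInf fun S => by
    refine ⟨?_⟩
    rw [Subgroup.index_comap]
    exact Subgroup.FiniteIndex.index_ne_zero (H := H0.subgroupOf (rho S).range)

end RACG
end FigEight

namespace FigEight

section Gal
variable {X : Type} {adj : X → X → Prop} {Q : Type} [Group Q] (π : RACG adj →* Q)

/-- image of the star subgroup -/
noncomputable def pbar (x : X) : Subgroup Q := ((rho (adj := adj) (St adj x)).range).map π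

lemma rg_mem_pbar {x y : X} (h : y ∈ St adj x) : π (rg y) ∈ pbar π x :=
  ⟨rg y, ⟨rg y, rho_mem h⟩, rfl⟩

noncomputable def gal : Q → List X → List (X × Set Q)
  | _, [] => []
  | q, f :: l => (f, {r | q⁻¹ * r ∈ pbar π f}) :: gal (q * π (rg f)) l

lemma coset_eq (P : Subgroup Q) {q r : Q} (h : q⁻¹ * r ∈ P) :
    {s | q⁻¹ * s ∈ P} = {s | r⁻¹ * s ∈ P} := by
  ext s
  simp only [Set.mem_ofPred_eq]
  have : r⁻¹ * s = (q⁻¹ * r)⁻¹ * (q⁻¹ * s) := by group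
  rw [this]
  exact (P.mul_mem_cancel_left (P.inv_mem h)).symm

lemma coset_mem (P : Subgroup Q) {q r : Q} (h : {s | q⁻¹ * s ∈ P} = {s | r⁻¹ * s ∈ P}) :
    q⁻¹ * r ∈ P := by
  have : r ∈ {s | r⁻¹ * s ∈ P} := by simp
  rw [← h] at this
  exact this

lemma coset_star {x y : X} (h : y ∈ St adj x) (q : Q) :
    {s | (q * π (rg y))⁻¹ * s ∈ pbar π x} = {s | q⁻¹ * s ∈ pbar π x} := by
  symm
  apply coset_eq
  simpa using rg_mem_pbar π h

@[simp] lemma gal_length (q : Q) (l : List X) : (gal π q l).length = l.length := by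
  induction l generalizing q with
  | nil => rfl
  | cons f l ih => simp [gal, ih]

lemma gal_append (q : Q) (l l' : List X) :
    gal π q (l ++ l') = gal π q l ++ gal π (q * π (wprod l)) l' := by
  induction l generalizing q with
  | nil => simp [gal]
  | cons f l ih => simp [gal, ih, mul_assoc]

lemma gal_split {q : Q} {l : List X} {w w' : List (X × Set Q)} (h : gal π q l = w ++ w') :
    ∃ l1 l2, l = l1 ++ l2 ∧ gal π q l1 = w ∧ gal π (q * π (wprod l1)) l2 = w' := by
  induction w generalizing q l with
  | nil => exact ⟨[], l, rfl, rfl, by simpa using h⟩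
  | cons E w ih =>
    cases l with
    | nil => simp [gal] at h
    | cons f l =>
      simp only [gal, List.cons_append, List.cons.injEq] at h
      obtain ⟨l1, l2, rfl, h1, h2⟩ := ih h.2
      exact ⟨f :: l1, l2, rfl, by simp [gal, h.1, h1], by simpa [mul_assoc] using h2⟩

lemma gal_cons2 {q : Q} {l : List X} {E E' : X × Set Q} {w : List (X × Set Q)}
    (h : gal π q l = E :: E' :: w) :
    ∃ l', l = E.1 :: E'.1 :: l' ∧ E.2 = {r | q⁻¹ * r ∈ pbar π E.1} ∧
      E'.2 = {r | (q * π (rg E.1))⁻¹ * r ∈ pbar π E'.1} ∧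
      gal π (q * π (rg E.1) * π (rg E'.1)) l' = w := by
  match l, h with
  | [], h => simp [gal] at h
  | [_], h => simp [gal] at h
  | f :: g :: l', h =>
    simp only [gal, List.cons.injEq] at h
    obtain ⟨rfl, rfl, h'⟩ := h
    exact ⟨l', rfl, rfl, rfl, h'⟩

/-- centraliser argument -/
lemma gal_central (hst : ∀ S : Set X, ∀ w, π w = 1 → π (rho S w) = 1) (l : List X) :
    ∀ (S : Set X) (d u v : RACG adj), rho S d = d → π v = π u * π d →
      gal π (π u) l = gal π (π v) l →
      ∃ (S' : Set X) (d' : RACG adj), S' ⊆ S ∧ rho S' d' = d' ∧ π d' = π d ∧ Commute d' (wprod l) := by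
  induction l with
  | nil =>
    intro S d u v hd _ _
    exact ⟨S, d, subset_rfl, hd, rfl, by simp⟩
  | cons f l ih =>
    intro S d u v hd hv hg
    simp only [gal, List.cons.injEq, Prod.mk.injEq, true_and] at hg
    obtain ⟨hc, hg⟩ := hg
    have h1 := coset_mem _ hc
    rw [hv] at h1
    simp only [inv_mul_cancel_left] at h1
    obtain ⟨_, ⟨e, rfl⟩, he⟩ := h1
    let d1 := rho (St adj f) d
    have h2 : π d1 = π d := by
      have h3 := hst (St adj f) ((rho (St adj f) e)⁻¹ * d) (by simp [he])
      simp only [map_mul, map_inv, rho_rho, Set.inter_self] at h3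
      rw [inv_mul_eq_one] at h3
      rw [← he, h3]
    have hd1 : rho (S ∩ St adj f) d1 = d1 := by
      change rho _ (rho _ d) = rho _ d
      rw [rho_rho, Set.inter_assoc, Set.inter_self, ]
      conv_rhs => rw [← hd, rho_rho, Set.inter_comm]
    have hcm : Commute d1 (rg f) := rho_commute subset_rfl d
    obtain ⟨S', d', hS', hd', hπ, hcm'⟩ := ih (S ∩ St adj f) d1 (u * rg f) (v * rg f) hd1 (by
      have h5 := congrArg π hcm.eq
      rw [map_mul, map_mul] at h5
      rw [map_mul, map_mul, hv, ← h2, mul_assoc, mul_assoc, h5])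
      (by simpa using hg)
    refine ⟨S', d', hS'.trans Set.inter_subset_left, hd', hπ.trans h2, ?_⟩
    rw [wprod_cons]
    refine Commute.mul_right ?_ hcm'
    rw [← hd']
    exact rho_commute (hS'.trans Set.inter_subset_right) d'

end Gal

section P1
variable {X : Type} {adj : X → X → Prop}

/-- `n` is the conjugacy length of `x`. -/
def IsMinLen (x : RACG adj) (n : ℕ) : Prop :=
  (∃ l u, l.length = n ∧ u * wprod l * u⁻¹ = x) ∧
    ∀ l u, u * wprod l * u⁻¹ = x → n ≤ l.length

lemma exists_minLen (x : RACG adj) : ∃ n, IsMinLen x n := by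
  classical
  have h : ∃ n, ∃ (l : List X) (u : RACG adj), l.length = n ∧ u * wprod l * u⁻¹ = x := by
    obtain ⟨l, hl⟩ := exists_word x
    exact ⟨l.length, l, 1, rfl, by simp [hl]⟩
  exact ⟨Nat.find h, Nat.find_spec h, fun l u hl => Nat.find_min' h ⟨l, u, rfl, hl⟩⟩

theorem racg_sep_aux [Finite X] (hsym : ∀ x y, adj x y → adj y x) (H : Subgroup (RACG adj)) [H.Normal]
    [H.FiniteIndex] (hst : ∀ S : Set X, ∀ w ∈ H, rho S w ∈ H) (x y : H) (n m : ℕ)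
    (hn : IsMinLen (x : RACG adj) n) (hm : IsMinLen (y : RACG adj) m) (hmn : m ≤ n) :
    ∃ (K : Type) (_ : Group K) (_ : Finite K) (c : H →* K),
      IsConj (c x) (c y) → ∃ h ∈ H, h * (x : RACG adj) * h⁻¹ = y := by
  classical
  obtain ⟨Q, iQ, hfQ, π, hπ⟩ : ∃ (Q : Type) (_ : Group Q) (_ : Finite Q) (π : RACG adj →* Q),
      ∀ w, π w = 1 ↔ w ∈ H :=
    ⟨RACG adj ⧸ H, inferInstance, inferInstance, QuotientGroup.mk' H,
      fun w => QuotientGroup.eq_one_iff w⟩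
  let T : Set (List (X × Set Q)) :=
    {e | ∃ l u, l.length = n ∧ u * wprod l * u⁻¹ = (x : RACG adj) ∧ e = gal π (π u) l}
  have hTfin : T.Finite := by
    refine (List.finite_length_eq (X × Set Q) n).subset ?_
    rintro e ⟨l, u, hl, _, rfl⟩
    simp [hl]
  let S : Finset (List (X × Set Q)) := hTfin.toFinset
  have hS : ∀ e, e ∈ S ↔ ∃ l u, l.length = n ∧ u * wprod l * u⁻¹ = (x : RACG adj) ∧ e = gal π (π u) l :=
    fun e => Set.Finite.mem_toFinset _
  have hlen : ∀ w ∈ S, w.length = n := by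
    intro e he
    obtain ⟨l, u, hl, _, rfl⟩ := (hS e).1 he
    simp [hl]
  have hone : ∀ (l : List X) (u : RACG adj) (z : H), u * wprod l * u⁻¹ = (z : RACG adj) → π (wprod l) = 1 := by
    intro l u z h
    rw [hπ]
    have : wprod l = u⁻¹ * (z : RACG adj) * u⁻¹⁻¹ := by rw [← h]; group
    rw [this]
    exact Subgroup.Normal.conj_mem inferInstance _ z.2 _
  have hrot : ∀ w w', w ++ w' ∈ S → w' ++ w ∈ S := by
    intro w w' h
    obtain ⟨l, u, hl, hx, he⟩ := (hS _).1 h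
    have h1 := hone l u x hx
    obtain ⟨l1, l2, rfl, rfl, rfl⟩ := gal_split π he.symm
    rw [hS]
    refine ⟨l2 ++ l1, u * wprod l1, ?_, ?_, ?_⟩
    · rw [← hl]; simp [add_comm]
    · rw [← hx]; simp only [wprod_append]; group
    · rw [gal_append, map_mul]
      congr 2
      rw [wprod_append, map_mul] at h1
      rw [mul_assoc, h1, mul_one]
  have hsq : ∀ E E' : X × Set Q, E.1 = E'.1 → ∀ w w', w ++ E :: E' :: w' ∉ S := by
    intro E E' hEE w w' h
    obtain ⟨l, u, hl, hx, he⟩ := (hS _).1 h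
    obtain ⟨l1, l2, rfl, rfl, h2⟩ := gal_split π he.symm
    obtain ⟨l', rfl, -⟩ := gal_cons2 π h2
    have := hn.2 (l1 ++ l') u (by
      rw [← hx]
      simp only [wprod_append, wprod_cons, ← hEE]
      rw [← mul_assoc (rg E.1) (rg E.1), rg_sq, one_mul])
    rw [← hl] at this
    simp at this
  have hswap : ∀ E E' : X × Set Q, adj E.1 E'.1 → ∀ w w', w ++ E :: E' :: w' ∈ S →
      w ++ E' :: E :: w' ∈ S := by
    rintro ⟨f, A⟩ ⟨g, B⟩ hEE w w' h
    simp only at hEE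
    obtain ⟨l, u, hl, hx, he⟩ := (hS _).1 h
    obtain ⟨l1, l2, rfl, rfl, h2⟩ := gal_split π he.symm
    obtain ⟨l', rfl, hA, hB, rfl⟩ := gal_cons2 π h2
    simp only at hA hB
    rw [hS]
    refine ⟨l1 ++ g :: f :: l', u, ?_, ?_, ?_⟩
    · rw [← hl]; simp
    · rw [← hx]; simp only [wprod_append, wprod_cons]
      rw [← mul_assoc (rg f), rg_comm hEE, mul_assoc (rg g)]
    · rw [gal_append]
      congr 1
      simp only [gal]
      rw [coset_star π (x := g) (y := f) (Or.inr (hsym _ _ hEE))] at hB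
      rw [coset_star π (x := f) (y := g) (Or.inr hEE), hA, hB]
      congr 3
      have h5 := congrArg π (rg_comm hEE)
      rw [map_mul, map_mul] at h5
      rw [mul_assoc _ (π (rg f)), h5, ← mul_assoc]
  obtain ⟨R, _, hR, z, τ, hτ, h2, hz0, hzc, hτS⟩ := synt_exists S n hlen hrot
  -- the units
  have hu : ∀ E, (1 + z E) * (1 + z E) = 1 := by
    intro E
    have := hz0 E E (hsq E E rfl)
    have h3 := h2 (z E)
    calc (1 + z E) * (1 + z E) = 1 + (z E + z E) + z E * z E := by noncomm_ring
      _ = 1 := by rw [this, h3]; simp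
  let U : X × Set Q → Rˣ := fun E => ⟨1 + z E, 1 + z E, hu E, hu E⟩
  let gm : X → Mono Q Rˣ := fun f =>
    ⟨Equiv.mulRight (π (rg f))⁻¹, fun q => U (f, {r | q⁻¹ * r ∈ pbar π f})⟩
  have hUc : ∀ E E' : X × Set Q, adj E.1 E'.1 → U E * U E' = U E' * U E := by
    intro E E' h
    apply Units.ext
    have := hzc E E' (fun w w' => ⟨hswap E E' h w w', hswap E' E (hsym _ _ h) w w'⟩)
    change (1 + z E) * (1 + z E') = (1 + z E') * (1 + z E)
    have e1 : (1 + z E) * (1 + z E') = 1 + z E + z E' + z E * z E' := by noncomm_ring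
    have e2 : (1 + z E') * (1 + z E) = 1 + z E + z E' + z E' * z E := by
      rw [add_mul, mul_add, mul_add]; simp only [one_mul, mul_one]; abel
    rw [e1, e2, this]
  have hsqπ : ∀ f : X, (π (rg f))⁻¹ = π (rg f) := by
    intro f; rw [← map_inv, rg_inv]
  let Θ : RACG adj →* Mono Q Rˣ := racgLift gm
    (by
      intro f
      ext q
      · simp only [gm, Mono.mul_perm, Equiv.Perm.mul_apply, Equiv.coe_mulRight, Mono.one_perm,
          Equiv.Perm.one_apply, hsqπ]
        rw [mul_assoc, ← map_mul, rg_sq]; simp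
      · simp only [gm, Mono.mul_lab, Mono.one_lab, Equiv.coe_mulRight, hsqπ]
        rw [coset_star π (Or.inl rfl)]
        exact hu _)
    (by
      intro f g hfg
      ext q
      · simp only [gm, Mono.mul_perm, Equiv.Perm.mul_apply, Equiv.coe_mulRight, hsqπ]
        rw [mul_assoc, mul_assoc, ← map_mul, ← map_mul, rg_comm hfg]
      · simp only [gm, Mono.mul_lab, Equiv.coe_mulRight, hsqπ]
        rw [coset_star π (Or.inr hfg), coset_star π (Or.inr (hsym _ _ hfg))]
        exact congrArg Units.val (hUc _ _ hfg))
  have hperm : ∀ w q, (Θ w).perm q = q * (π w)⁻¹ := by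
    intro w
    obtain ⟨l, rfl⟩ := exists_word w
    induction l with
    | nil => intro q; simp
    | cons f l ih =>
      intro q
      rw [wprod_cons, map_mul, Mono.mul_perm, Equiv.Perm.mul_apply, ih]
      rw [show Θ (rg f) = gm f from racgLift_rg _ _ _ f]
      simp [gm, mul_assoc]
  have hlab : ∀ l q, (Θ (wprod l)).lab (q * π (wprod l)) = ((gal π q l).map U).prod := by
    intro l
    induction l with
    | nil => intro q; simp [gal]
    | cons f l ih =>
      intro q
      rw [wprod_cons, map_mul, map_mul, Mono.mul_lab, hperm]
      rw [show Θ (rg f) = gm f from racgLift_rg _ _ _ f]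
      simp only [gal, List.map_cons, List.prod_cons]
      rw [← ih, ← mul_assoc q, mul_inv_cancel_right]
      congr 1
      simp only [gm]
      rw [coset_star π (Or.inl rfl)]
  let c : H →* Rˣ := Mono.stabHom Θ 1 H (by
    intro h hh
    rw [hperm, (hπ h).2 hh]; simp)
  have hc : ∀ (ζ : H) (l : List X) (u : RACG adj), u * wprod l * u⁻¹ = (ζ : RACG adj) →
      l.length ≤ n → (gal π (π u) l ∈ S → τ (c ζ : R) = 1) ∧
        (gal π (π u) l ∉ S → τ (c ζ : R) = 0) := by
    intro ζ l u h hl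
    have h1 := hone l u ζ h
    have e1 : c ζ = (Θ u).lab (π u) * ((gal π (π u) l).map U).prod * ((Θ u).lab (π u))⁻¹ := by
      change (Θ (ζ : RACG adj)).lab 1 = _
      rw [← h, map_mul, map_mul, map_inv, ← hlab, h1, mul_one]
      simp only [Mono.mul_lab, Mono.inv_lab, Mono.inv_perm]
      have e2 : (Θ u).perm⁻¹ 1 = π u := by
        rw [Equiv.Perm.inv_eq_iff_eq, hperm]; simp
      rw [e2, hperm, h1]; simp
    rw [e1, Units.val_mul, Units.val_mul, hτ, ← mul_assoc]
    simp only [Units.inv_mul, one_mul]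
    have h6 := hτS (gal π (π u) l) (by rw [gal_length]; exact hl)
    have h7 : (((gal π (π u) l).map U).prod : R) = ((gal π (π u) l).map fun x => 1 + z x).prod := by
      induction gal π (π u) l with
      | nil => simp
      | cons a t ih => simp only [List.map_cons, List.prod_cons, Units.val_mul, ih]; rfl
    rw [h7]
    exact h6
  refine ⟨Rˣ, inferInstance, inferInstance, c, fun hconj => ?_⟩
  obtain ⟨⟨l, u, hl, hx⟩, -⟩ := hn
  obtain ⟨⟨l', v, hl', hy⟩, -⟩ := hm
  have t1 : τ (c x : R) = 1 := by
    apply (hc x l u hx hl.le).1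
    rw [hS]; exact ⟨l, u, hl, hx, rfl⟩
  have t2 : τ (c y : R) = 1 := by
    obtain ⟨k, hk⟩ := isConj_iff.1 hconj
    rw [← hk, Units.val_mul, Units.val_mul, hτ, ← mul_assoc, Units.inv_mul, one_mul, t1]
  have t3 : gal π (π v) l' ∈ S := by
    by_contra h
    rw [(hc y l' v hy (hl'.trans_le hmn)).2 h] at t2
    exact absurd t2 (by decide)
  obtain ⟨l2, u2, hl2, hx2, he⟩ := (hS _).1 t3
  have hll : l' = l2 := by
    have key : ∀ (q : Q) (k : List X), (gal π q k).map Prod.fst = k := by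
      intro q k
      induction k generalizing q with
      | nil => rfl
      | cons f k ih => simp [gal, ih]
    rw [← key (π v) l', he, key]
  subst hll
  obtain ⟨S', d, -, -, hd, hcm⟩ := gal_central π (by
      intro S w hw
      rw [hπ] at *
      exact hst S w hw) l' Set.univ (u2⁻¹ * v) u2 v (rho_univ _) (by simp) he.symm
  refine ⟨v * d⁻¹ * u2⁻¹, ?_, ?_⟩
  · rw [← hπ]; simp [hd]
  · rw [← hx2, ← hy]
    have := hcm.eq
    have e3 : wprod l' = d⁻¹ * wprod l' * d := by
      rw [mul_assoc, ← this]; group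
    conv_rhs => rw [e3]
    group

theorem racg_sep [Finite X] (hsym : ∀ x y, adj x y → adj y x) (H : Subgroup (RACG adj)) [H.Normal]
    [H.FiniteIndex] (hst : ∀ S : Set X, ∀ w ∈ H, rho S w ∈ H) (x y : H) :
    ∃ (K : Type) (_ : Group K) (_ : Finite K) (c : H →* K),
      IsConj (c x) (c y) → ∃ h ∈ H, h * (x : RACG adj) * h⁻¹ = y := by
  obtain ⟨n, hn⟩ := exists_minLen (x : RACG adj)
  obtain ⟨m, hm⟩ := exists_minLen (y : RACG adj)
  rcases le_total m n with h | h
  · exact racg_sep_aux hsym H hst x y n m hn hm h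
  · obtain ⟨K, i1, i2, c, hc⟩ := racg_sep_aux hsym H hst y x m n hm hn h
    refine ⟨K, i1, i2, c, fun hk => ?_⟩
    obtain ⟨k, hk, hk'⟩ := hc hk.symm
    exact ⟨k⁻¹, H.inv_mem hk, by rw [← hk']; group⟩

end P1
end FigEight

namespace FigEight

section words

def cancelW (adj : Fin 8 → Fin 8 → Bool) (x : Fin 8) : List (Fin 8) → Option (List (Fin 8))
  | [] => none
  | y :: l => if x = y then some l else if adj x y then (cancelW adj x l).map (y :: ·) else none

def redW (adj : Fin 8 → Fin 8 → Bool) : List (Fin 8) → List (Fin 8)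
  | [] => []
  | x :: l => match cancelW adj x (redW adj l) with
    | some l' => l'
    | none => x :: redW adj l

def phiP : Fin 3 → Fin 10 → Fin 10 :=
  ![![2, 0, 6, 7, 3, 1, 5, 9, 4, 8],
    ![4, 2, 5, 0, 7, 9, 1, 8, 3, 6],
    ![3, 1, 4, 9, 8, 0, 2, 7, 6, 5]]

def phiI : Fin 3 → Fin 10 → Fin 10 :=
  ![![1, 5, 0, 4, 8, 6, 2, 3, 9, 7],
    ![3, 6, 1, 8, 0, 2, 9, 4, 7, 5],
    ![5, 1, 6, 0, 2, 9, 8, 7, 4, 3]]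

def phiL : Fin 3 → Fin 10 → List (Fin 8) :=
  ![![[], [], [0,2,4,6], [], [1,5,0,4], [0,1,6,2], [0,4,1,0], [1,3,5,0,5,7], [0,4,7,3], [5,0]],
    ![[], [4,1,5,0], [1,4], [], [0,7,3,4], [3,5,2,4], [], [3,5,0,4,5,7], [], [0,1,2,4,1,3]],
    ![[5,0], [0,4,1,0], [0,4,5,4], [], [3,5,4,7], [], [1,6,0,2], [5,0], [0,1,0,2,3,5], [1,2,3,5]]]

def usW : Fin 10 → List (Fin 6) :=
  ![[], [0], [3], [1], [4], [2], [0,1], [1,3], [1,1], [1,5]]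

/-- indexed by the point first, then the generator -/
def psiP : Fin 8 → Fin 8 → Fin 8 :=
  ![![1, 2, 3, 4, 2, 1, 4, 3],
    ![0, 5, 6, 7, 5, 0, 7, 6],
    ![5, 0, 7, 6, 0, 5, 6, 7],
    ![6, 7, 0, 5, 7, 6, 5, 0],
    ![7, 6, 5, 0, 6, 7, 0, 5],
    ![2, 1, 4, 3, 1, 2, 3, 4],
    ![3, 4, 1, 2, 4, 3, 2, 1],
    ![4, 3, 2, 1, 3, 4, 1, 2]]

def psiL : Fin 8 → Fin 8 → List (Fin 6) :=
  ![![[], [], [], [], [2,1,0], [5,4], [5,1,5,5,0], [2,0,2,2,1]],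
    ![[], [], [], [], [0,5,3], [1,2], [5,5,5,3,3], [2,0,2,2,1]],
    ![[0,1,3,4,5,5], [], [5,5,5,5], [0,1,2,4,2], [3,4,5], [5,4], [0,1,5,0], [5,1,3,3,4]],
    ![[], [5,5,5,5], [], [5,5,5,5], [5,5,1,5], [2,0,1,5,5], [0,0,5], [4,5,5,3,5]],
    ![[], [0,1,2,4,2], [0,1,2,4,2], [], [2,4,2,2], [5,4], [3,2,2,4,2], [5,0,0,4,4]],
    ![[1,0,0,2,3,2], [], [1,5,4,3,5], [2,2,2,2], [0,2,3], [1,2], [2,3,3], [1,1,3,3,2]],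
    ![[], [1,5,4,3,5], [], [1,5,4,3,5], [5,5,1,5], [2,2,4,3,5], [3,2,4,3], [4,5,5,3,5]],
    ![[], [2,2,2,2], [2,2,2,2], [], [2,4,2,2], [1,2], [0,0,2,2,2], [1,0,0,4,2]]]

def adjB : Fin 8 → Fin 8 → Bool :=
  ![![false, false, true, true, true, false, false, true],
    ![false, false, true, true, false, true, true, false],
    ![true, true, false, false, true, false, false, false],
    ![true, true, false, false, false, true, false, false],
    ![true, false, true, false, false, false, true, true],
    ![false, true, false, true, false, false, true, true],
    ![false, true, false, false, true, true, false, false],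
    ![true, false, false, false, true, true, false, false]]

abbrev adjP (x y : Fin 8) : Prop := adjB x y = true
abbrev W8 := RACG adjP

lemma adjP_symm : ∀ x y, adjP x y → adjP y x := by decide

lemma cancelW_sound (x : Fin 8) : ∀ (l l' : List (Fin 8)), cancelW adjB x l = some l' →
    (wprod l' : W8) = rg x * wprod l := by
  intro l
  induction l with
  | nil => intro l' h; simp [cancelW] at h
  | cons y l ih =>
    intro l' h
    rw [cancelW] at h
    split_ifs at h with h1 h2
    · subst h1
      cases h
      rw [wprod_cons, ← mul_assoc, rg_sq, one_mul]
    · rw [Option.map_eq_some_iff] at h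
      obtain ⟨m, hm, rfl⟩ := h
      rw [wprod_cons, wprod_cons, ih m hm, ← mul_assoc, ← mul_assoc, rg_comm (show adjP x y from h2)]

lemma redW_sound (l : List (Fin 8)) : (wprod (redW adjB l) : W8) = wprod l := by
  induction l with
  | nil => rfl
  | cons x l ih =>
    rw [redW, wprod_cons, ← ih]
    split
    · next l' h => exact cancelW_sound x _ _ h
    · rw [wprod_cons]

lemma wprod_reverse (l : List (Fin 8)) : (wprod l.reverse : W8) = (wprod l)⁻¹ := by
  induction l with
  | nil => simp
  | cons x l ih => simp [ih, rg_inv]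

lemma wprod_eq_of_red {l l' : List (Fin 8)} (h : redW adjB (l ++ l'.reverse) = []) :
    (wprod l : W8) = wprod l' := by
  have := redW_sound (l ++ l'.reverse)
  rw [h, wprod_append, wprod_reverse, wprod_nil] at this
  exact (mul_inv_eq_one.1 this.symm)

abbrev G8 := FigureEightKnotGroup

def ga : G8 := PresentedGroup.of 0
def gb : G8 := PresentedGroup.of 1
def gt : G8 := PresentedGroup.of 2

lemma g_rel1 : gt * ga * gt⁻¹ = ga * gb * ga := by
  have := PresentedGroup.one_of_mem (rels := {FreeGroup.of (2 : Fin 3) * FreeGroup.of (0 : Fin 3) *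
        (FreeGroup.of (2 : Fin 3))⁻¹ *
        (FreeGroup.of (0 : Fin 3) * FreeGroup.of (1 : Fin 3) *
          FreeGroup.of (0 : Fin 3))⁻¹,
      FreeGroup.of (2 : Fin 3) * FreeGroup.of (1 : Fin 3) *
        (FreeGroup.of (2 : Fin 3))⁻¹ *
        (FreeGroup.of (1 : Fin 3) * FreeGroup.of (0 : Fin 3))⁻¹}) (Or.inl rfl)
  have h2 : gt * ga * gt⁻¹ * (ga * gb * ga)⁻¹ = 1 := this
  exact mul_inv_eq_one.1 h2

lemma g_rel2 : gt * gb * gt⁻¹ = gb * ga := by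
  have := PresentedGroup.one_of_mem (rels := {FreeGroup.of (2 : Fin 3) * FreeGroup.of (0 : Fin 3) *
        (FreeGroup.of (2 : Fin 3))⁻¹ *
        (FreeGroup.of (0 : Fin 3) * FreeGroup.of (1 : Fin 3) *
          FreeGroup.of (0 : Fin 3))⁻¹,
      FreeGroup.of (2 : Fin 3) * FreeGroup.of (1 : Fin 3) *
        (FreeGroup.of (2 : Fin 3))⁻¹ *
        (FreeGroup.of (1 : Fin 3) * FreeGroup.of (0 : Fin 3))⁻¹}) (Or.inr rfl)
  have h2 : gt * gb * gt⁻¹ * (gb * ga)⁻¹ = 1 := this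
  exact mul_inv_eq_one.1 h2

def g8Lift {K : Type*} [Group K] (f : Fin 3 → K) (h1 : f 2 * f 0 = f 0 * f 1 * f 0 * f 2)
    (h2 : f 2 * f 1 = f 1 * f 0 * f 2) : G8 →* K :=
  PresentedGroup.toGroup (f := f) (by
    rintro r (rfl | rfl)
    · simp only [map_mul, map_inv, FreeGroup.lift_apply_of, h1]; group
    · simp only [map_mul, map_inv, FreeGroup.lift_apply_of, h2]; group)

lemma g8Lift_of {K : Type*} [Group K] (f : Fin 3 → K) (h1 : f 2 * f 0 = f 0 * f 1 * f 0 * f 2)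
    (h2 : f 2 * f 1 = f 1 * f 0 * f 2) (x : Fin 3) :
    g8Lift f h1 h2 (PresentedGroup.of x) = f x := PresentedGroup.toGroup.of _

def gl : Fin 6 → G8 := ![ga, gb, gt, ga⁻¹, gb⁻¹, gt⁻¹]

def gprod (l : List (Fin 6)) : G8 := (l.map gl).prod

@[simp] lemma gprod_nil : gprod [] = 1 := rfl
@[simp] lemma gprod_cons (x : Fin 6) (l : List (Fin 6)) : gprod (x :: l) = gl x * gprod l := by
  simp [gprod]
@[simp] lemma gprod_append (l l' : List (Fin 6)) : gprod (l ++ l') = gprod l * gprod l' := by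
  simp [gprod]

lemma gl_inv (x : Fin 6) : gl (x + 3) = (gl x)⁻¹ := by
  fin_cases x <;> simp [gl]

def invL (l : List (Fin 6)) : List (Fin 6) := (l.map (· + 3)).reverse

lemma gprod_invL (l : List (Fin 6)) : gprod (invL l) = (gprod l)⁻¹ := by
  induction l with
  | nil => simp [invL]
  | cons x l ih =>
    have : invL (x :: l) = invL l ++ [x + 3] := by simp [invL]
    rw [this, gprod_append, ih, gprod_cons, gprod_cons, gl_inv]; simp

def pushL (c : Fin 6) : List (Fin 6) → List (Fin 6)
  | [] => [c]
  | d :: r => if d = c + 3 then r else c :: d :: r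

lemma gprod_pushL (c : Fin 6) (l : List (Fin 6)) : gprod (pushL c l) = gl c * gprod l := by
  cases l with
  | nil => simp [pushL]
  | cons d r =>
    rw [pushL]
    split_ifs with h
    · rw [h, gprod_cons, gl_inv, mul_inv_cancel_left]
    · simp

def pushs (l m : List (Fin 6)) : List (Fin 6) := l.foldr pushL m

lemma gprod_pushs (l m : List (Fin 6)) : gprod (pushs l m) = gprod l * gprod m := by
  induction l with
  | nil => simp [pushs]
  | cons c l ih =>
    change gprod (pushL c (pushs l m)) = _
    rw [gprod_pushL, ih, gprod_cons]
    exact (mul_assoc (gl c) (gprod l) (gprod m)).symm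

def subL (σ : Fin 6 → List (Fin 6)) : List (Fin 6) → List (Fin 6)
  | [] => []
  | c :: l => pushs (σ c) (subL σ l)

lemma gprod_subL (σ : Fin 6 → List (Fin 6)) (s : G8)
    (h : ∀ c, gprod (σ c) = s * gl c * s⁻¹) (l : List (Fin 6)) :
    gprod (subL σ l) = s * gprod l * s⁻¹ := by
  induction l with
  | nil => simp [subL]
  | cons c l ih => rw [subL, gprod_pushs, ih, h, gprod_cons]; group

def sigP : Fin 6 → List (Fin 6) := ![[0,1,0], [1,0], [2], [3,4,3], [3,4], [5]]
def sigM : Fin 6 → List (Fin 6) := ![[0,4], [1,1,3], [2], [1,3], [0,4,4], [5]]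

lemma sigP_spec (c : Fin 6) : gprod (sigP c) = gt * gl c * gt⁻¹ := by
  have h1 := g_rel1
  have h2 := g_rel2
  fin_cases c
  · simp [sigP, gl, h1, mul_assoc]
  · simp [sigP, gl, h2, mul_assoc]
  · simp [sigP, gl]
  · have := congrArg (·⁻¹) h1
    simp [mul_assoc] at this
    simp [sigP, gl, this, mul_assoc]
  · have := congrArg (·⁻¹) h2
    simp [mul_assoc] at this
    simp [sigP, gl, this, mul_assoc]
  · simp [sigP, gl]

lemma conj_gt_mul (x y : G8) : gt * (x * y) * gt⁻¹ = (gt * x * gt⁻¹) * (gt * y * gt⁻¹) := by group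
lemma conj_gt_inv (x : G8) : gt * x⁻¹ * gt⁻¹ = (gt * x * gt⁻¹)⁻¹ := by group

lemma sigM_spec (c : Fin 6) : gprod (sigM c) = gt⁻¹ * gl c * (gt⁻¹)⁻¹ := by
  have h1 := g_rel1
  have h2 := g_rel2
  suffices h : gt * gprod (sigM c) * gt⁻¹ = gl c by
    rw [← h]; group
  fin_cases c
  all_goals
    simp only [sigM, gl, Fin.zero_eta, Fin.isValue, Fin.mk_one, Fin.reduceFinMk, Matrix.cons_val,
      Matrix.cons_val_zero, Matrix.cons_val_one, gprod_cons, gprod_nil, mul_one, conj_gt_mul, conj_gt_inv, h1, h2]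
  all_goals group

/-- normal form -/
def nfG : List (Fin 6) → List (Fin 6) × ℤ
  | [] => ([], 0)
  | c :: l => if c = 2 then (subL sigP (nfG l).1, (nfG l).2 + 1)
      else if c = 5 then (subL sigM (nfG l).1, (nfG l).2 - 1)
      else (pushL c (nfG l).1, (nfG l).2)

lemma nfG_sound (l : List (Fin 6)) : gprod l = gprod (nfG l).1 * gt ^ (nfG l).2 := by
  induction l with
  | nil => simp [nfG]
  | cons c l ih =>
    rw [nfG, gprod_cons, ih]
    split_ifs with h1 h2
    · subst h1
      simp only [gprod_subL _ _ sigP_spec, zpow_add]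
      simp only [gl, Fin.isValue, Matrix.cons_val]
      group
    · subst h2
      simp only [gprod_subL _ _ sigM_spec, zpow_sub]
      simp only [gl, Fin.isValue, Matrix.cons_val]
      group
    · simp only [gprod_pushL, mul_assoc]

lemma gprod_eq_of_nf {l l' : List (Fin 6)} (h : nfG (l ++ invL l') = ([], 0)) :
    gprod l = gprod l' := by
  have := nfG_sound (l ++ invL l')
  rw [h, gprod_append, gprod_invL] at this
  simp only [gprod_nil, zpow_zero, mul_one] at this
  exact mul_inv_eq_one.1 this

end words

/-- images of the generators of the knot group -/
def phiGen (g : Fin 3) : Mono (Fin 10) W8 where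
  perm := ⟨phiP g, phiI g, by revert g; decide, by revert g; decide⟩
  lab s := wprod (phiL g s)

lemma phiGen_perm (g : Fin 3) (s : Fin 10) : (phiGen g).perm s = phiP g s := rfl
lemma phiGen_lab (g : Fin 3) (s : Fin 10) : (phiGen g).lab s = wprod (phiL g s) := rfl

def phiHom : G8 →* Mono (Fin 10) W8 := g8Lift phiGen
  (by
    ext s
    · simp only [Mono.mul_perm, Equiv.Perm.mul_apply, phiGen_perm]
      revert s; decide
    · simp only [Mono.mul_lab, Mono.mul_perm, Equiv.Perm.mul_apply, phiGen_perm, phiGen_lab,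
        ← wprod_append]
      apply wprod_eq_of_red
      revert s; decide +kernel)
  (by
    ext s
    · simp only [Mono.mul_perm, Equiv.Perm.mul_apply, phiGen_perm]
      revert s; decide
    · simp only [Mono.mul_lab, Mono.mul_perm, Equiv.Perm.mul_apply, phiGen_perm, phiGen_lab,
        ← wprod_append]
      apply wprod_eq_of_red
      revert s; decide +kernel)

/-- images of the reflections -/
def psiGen (f : Fin 8) : Mono (Fin 8) G8 where
  perm := ⟨fun k => psiP k f, fun k => psiP k f, by revert f; decide +kernel,
    by revert f; decide +kernel⟩
  lab k := gprod (psiL k f)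

lemma psiGen_perm (f k : Fin 8) : (psiGen f).perm k = psiP k f := rfl
lemma psiGen_lab (f k : Fin 8) : (psiGen f).lab k = gprod (psiL k f) := rfl

def psiHom : W8 →* Mono (Fin 8) G8 := racgLift psiGen
  (by
    intro f
    ext s
    · simp only [Mono.mul_perm, Mono.one_perm, Equiv.Perm.one_apply, Equiv.Perm.mul_apply, psiGen_perm]
      revert f s; decide +kernel
    · simp only [Mono.mul_lab, Mono.one_lab, psiGen_perm, psiGen_lab, ← gprod_append, ← gprod_nil]
      apply gprod_eq_of_nf
      revert f s; decide +kernel)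
  (by
    intro f g h
    ext s
    · simp only [Mono.mul_perm, Equiv.Perm.mul_apply, psiGen_perm]
      revert f g s; decide +kernel
    · simp only [Mono.mul_lab, psiGen_perm, psiGen_lab, ← gprod_append]
      apply gprod_eq_of_nf
      revert f g s; decide +kernel)

def runP : List (Fin 8) → Fin 8 → Fin 8 × List (Fin 6)
  | [], k => (k, [])
  | x :: l, k => (psiP (runP l k).1 x, psiL (runP l k).1 x ++ (runP l k).2)

lemma runP_spec (l : List (Fin 8)) (k : Fin 8) :
    (psiHom (wprod l)).perm k = (runP l k).1 ∧ (psiHom (wprod l)).lab k = gprod (runP l k).2 := by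
  induction l with
  | nil => simp [runP]
  | cons x l ih =>
    have hx : psiHom (rg x) = psiGen x := racgLift_rg _ _ _ _
    rw [wprod_cons, map_mul, hx]
    simp only [Mono.mul_perm, Mono.mul_lab, Equiv.Perm.mul_apply, ih.1, ih.2, psiGen_perm,
      psiGen_lab, runP, gprod_append, and_self]

lemma table_check : ∀ (g : Fin 3) (s : Fin 10), (runP (phiL g s) 0).1 = 0 ∧
    nfG ((runP (phiL g s) 0).2 ++ usW s ++ invL (usW (phiP g s) ++ [Fin.castLE (by decide) g]))
      = ([], 0) := by
  decide +kernel

/-- the transfer statement -/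
lemma psi_phi (g : G8) : ∀ s, (psiHom ((phiHom g).lab s)).perm 0 = 0 ∧
    (psiHom ((phiHom g).lab s)).lab 0 * gprod (usW s) = gprod (usW ((phiHom g).perm s)) * g := by
  let H : Subgroup G8 :=
    { carrier := {g | ∀ s, (psiHom ((phiHom g).lab s)).perm 0 = 0 ∧
        (psiHom ((phiHom g).lab s)).lab 0 * gprod (usW s) =
          gprod (usW ((phiHom g).perm s)) * g}
      one_mem' := by intro s; simp
      mul_mem' := by
        intro x y hx hy s
        obtain ⟨hy1, hy2⟩ := hy s
        obtain ⟨hx1, hx2⟩ := hx ((phiHom y).perm s)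
        refine ⟨by simp [hx1, hy1], ?_⟩
        simp only [map_mul, Mono.mul_lab, Mono.mul_perm, Equiv.Perm.mul_apply, hy1]
        rw [mul_assoc, hy2, ← mul_assoc, hx2, mul_assoc]
      inv_mem' := by
        intro x hx s
        obtain ⟨h1, h2⟩ := hx ((phiHom x).perm⁻¹ s)
        have h3 : (psiHom ((phiHom x).lab ((phiHom x).perm⁻¹ s))).perm⁻¹ 0 = 0 := by
          rw [Equiv.Perm.inv_eq_iff_eq]; exact h1.symm
        simp only [map_inv, Mono.inv_lab, Mono.inv_perm]
        refine ⟨h3, ?_⟩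
        rw [h3, inv_mul_eq_iff_eq_mul, ← mul_assoc, h2]
        simp }
  refine PresentedGroup.generated_by _ H (fun x => ?_) g
  change ∀ s, _
  intro s
  have hx : phiHom (PresentedGroup.of x) = phiGen x := g8Lift_of _ _ _ _
  rw [hx, phiGen_perm, phiGen_lab]
  obtain ⟨h1, h2⟩ := table_check x s
  obtain ⟨h3, h4⟩ := runP_spec (phiL x s) 0
  refine ⟨by rw [h3, h1], ?_⟩
  rw [h4, ← gprod_append, gprod_eq_of_nf h2, gprod_append]
  congr 1
  fin_cases x <;> simp [gl, ga, gb, gt]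

end FigEight

namespace FigEight

section pingpong
open Matrix

/-- the two parabolic generators -/
def sanov (p : ℤ) : Fin 2 → SpecialLinearGroup (Fin 2) ℤ :=
  ![⟨!![1, p; 0, 1], by simp⟩, ⟨!![1, 0; p, 1], by simp⟩]

def ppX : Fin 2 → Set (SpecialLinearGroup (Fin 2) ℤ) :=
  ![{g | |g 1 0| ≤ |g 0 0| ∧ 0 ≤ g 0 0 * g 1 0}, {g | |g 0 0| < |g 1 0| ∧ 0 ≤ g 0 0 * g 1 0}]

def ppY : Fin 2 → Set (SpecialLinearGroup (Fin 2) ℤ) :=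
  ![{g | |g 1 0| < |g 0 0| ∧ g 0 0 * g 1 0 < 0}, {g | |g 0 0| ≤ |g 1 0| ∧ g 0 0 * g 1 0 < 0}]

lemma pp_aux1 {p x y : ℤ} (hp : 2 ≤ p) (h : ¬ (|y| < |x| ∧ x * y < 0)) :
    |y| ≤ |x + p * y| ∧ 0 ≤ (x + p * y) * y := by
  rw [← sq_le_sq]
  rw [← sq_lt_sq] at h
  by_cases h1 : x * y < 0
  · have h2 : x ^ 2 ≤ y ^ 2 := by by_contra h3; exact h ⟨not_le.1 h3, h1⟩
    have h3 : 0 ≤ x * y + y ^ 2 := by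
      have := sq_le_sq.1 h2
      have h4 : |x * y| ≤ y ^ 2 := by
        rw [abs_mul, ← sq_abs y, sq]; exact mul_le_mul_of_nonneg_right this (abs_nonneg y)
      linarith [neg_abs_le (x * y)]
    have hy := sq_nonneg y
    have h5 : y ^ 2 ≤ (x + p * y) * y := by nlinarith
    refine ⟨?_, by nlinarith⟩
    have h6 : |y ^ 2| ≤ |(x + p * y) * y| := abs_le_abs_of_nonneg hy h5
    rw [abs_mul, sq, abs_mul] at h6
    by_cases hy0 : y = 0
    · subst hy0; simpa using sq_nonneg x
    · exact sq_le_sq.2 (le_of_mul_le_mul_right h6 (abs_pos.2 hy0))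
  · have hy := sq_nonneg y
    have hx := sq_nonneg x
    rw [not_lt] at h1
    have h7 : 0 ≤ p * (x * y) := by positivity
    have hp2 : 4 ≤ p ^ 2 := by nlinarith
    have h8 : y ^ 2 ≤ p ^ 2 * y ^ 2 := by nlinarith
    exact ⟨by nlinarith, by nlinarith⟩

lemma pp_aux2 {p x y : ℤ} (hp : 2 ≤ p) (h : ¬ (|y| ≤ |x| ∧ 0 ≤ x * y)) :
    |y| < |x - p * y| ∧ (x - p * y) * y < 0 := by
  rw [← sq_lt_sq]
  rw [← sq_le_sq] at h
  by_cases h1 : 0 ≤ x * y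
  · have h2 : x ^ 2 < y ^ 2 := by by_contra h3; exact h ⟨not_lt.1 h3, h1⟩
    have hlt := sq_lt_sq.1 h2
    have hy0 : 0 < |y| := lt_of_le_of_lt (abs_nonneg x) hlt
    have h3 : x * y < y ^ 2 := by
      have h4 : |x * y| < y ^ 2 := by
        rw [abs_mul, ← sq_abs y, sq]; exact mul_lt_mul_of_pos_right hlt hy0
      linarith [le_abs_self (x * y)]
    have hy := sq_nonneg y
    have h5 : y ^ 2 < -((x - p * y) * y) := by nlinarith
    refine ⟨?_, by nlinarith⟩
    have h6 : |y ^ 2| < |-((x - p * y) * y)| := by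
      rw [abs_of_nonneg hy]; exact lt_of_lt_of_le h5 (le_abs_self _)
    rw [abs_neg, abs_mul, sq, abs_mul] at h6
    exact sq_lt_sq.2 (lt_of_mul_lt_mul_right h6 hy0.le)
  · have hy := sq_nonneg y
    have hx := sq_nonneg x
    rw [not_le] at h1
    have h7 : p * (x * y) ≤ 0 := by nlinarith
    have hp2 : 4 ≤ p ^ 2 := by nlinarith
    have h8 : y ^ 2 ≤ p ^ 2 * y ^ 2 := by nlinarith
    exact ⟨by nlinarith, by nlinarith⟩

lemma pp_aux3 {p x y : ℤ} (hp : 2 ≤ p) (h0 : ¬ (x = 0 ∧ y = 0)) (h : ¬ (|y| ≤ |x| ∧ x * y < 0)) :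
    |y| < |x + p * y| ∧ 0 ≤ (x + p * y) * y := by
  refine ⟨?_, (pp_aux1 hp (fun h' => h ⟨h'.1.le, h'.2⟩)).2⟩
  by_cases h1 : x * y < 0
  · have := (pp_aux2 (x := -x) (y := y) hp (fun h' => h ⟨by simpa using h'.1, h1⟩)).1
    rwa [show -x - p * y = -(x + p * y) by ring, abs_neg] at this
  · rw [← sq_lt_sq]
    have hy := sq_nonneg y
    have hx := sq_nonneg x
    rw [not_lt] at h1
    have h7 : 0 ≤ p * (x * y) := by positivity
    by_cases hy0 : y = 0
    · have : x ≠ 0 := fun h => h0 ⟨h, hy0⟩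
      subst hy0
      have := sq_pos_of_ne_zero this
      nlinarith
    · have := sq_pos_of_ne_zero hy0
      have hp2 : 4 ≤ p ^ 2 := by nlinarith
      have h8 : y ^ 2 < p ^ 2 * y ^ 2 := by nlinarith
      nlinarith

lemma pp_aux4 {p x y : ℤ} (hp : 2 ≤ p) (h0 : ¬ (x = 0 ∧ y = 0)) (h : ¬ (|y| < |x| ∧ 0 ≤ x * y)) :
    |y| ≤ |x - p * y| ∧ (x - p * y) * y < 0 := by
  have h1 := pp_aux1 (x := -x) (y := y) hp (by
    rintro ⟨h1, h2⟩
    exact h ⟨by simpa using h1, by linarith⟩)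
  rw [show -x + p * y = -(x - p * y) by ring, abs_neg] at h1
  refine ⟨h1.1, ?_⟩
  have hy0 : y ≠ 0 := by
    rintro rfl
    have : x ≠ 0 := fun h => h0 ⟨h, rfl⟩
    exact h ⟨by simpa using this, by simp⟩
  have hy := sq_pos_of_ne_zero hy0
  by_cases h2 : 0 ≤ x * y
  · have h3 : |x| ≤ |y| := by by_contra h3; exact h ⟨not_le.1 h3, h2⟩
    have h4 : |x * y| ≤ y ^ 2 := by
      rw [abs_mul, ← sq_abs y, sq]; exact mul_le_mul_of_nonneg_right h3 (abs_nonneg y)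
    nlinarith [le_abs_self (x * y)]
  · nlinarith

lemma sl2_col (g : SpecialLinearGroup (Fin 2) ℤ) : ¬ (g 0 0 = 0 ∧ g 1 0 = 0) := by
  rintro ⟨h1, h2⟩
  have := g.det_coe
  rw [Matrix.det_fin_two, h1, h2] at this
  simp at this

lemma sl2_mul_col (m g : SpecialLinearGroup (Fin 2) ℤ) (i : Fin 2) :
    (m * g) i 0 = m i 0 * g 0 0 + m i 1 * g 1 0 := by
  change (m.1 * g.1) i 0 = m.1 i 0 * g.1 0 0 + m.1 i 1 * g.1 1 0
  rw [Matrix.mul_apply, Fin.sum_univ_two]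

lemma sanov_inv (p : ℤ) (i : Fin 2) : (sanov p i)⁻¹ = sanov (-p) i := by
  apply inv_eq_of_mul_eq_one_right
  apply Subtype.ext
  change (sanov p i).1 * (sanov (-p) i).1 = 1
  fin_cases i <;> (ext j k; fin_cases j <;> fin_cases k <;> simp [sanov])

lemma sanov0 (p : ℤ) (g : SpecialLinearGroup (Fin 2) ℤ) :
    (sanov p 0 * g) 0 0 = g 0 0 + p * g 1 0 ∧ (sanov p 0 * g) 1 0 = g 1 0 := by
  constructor <;> rw [sl2_mul_col] <;> simp [sanov]

lemma sanov1 (p : ℤ) (g : SpecialLinearGroup (Fin 2) ℤ) :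
    (sanov p 1 * g) 0 0 = g 0 0 ∧ (sanov p 1 * g) 1 0 = g 1 0 + p * g 0 0 := by
  constructor <;> rw [sl2_mul_col] <;> simp [sanov, add_comm]

open scoped Pointwise in
theorem sanov_injective (p : ℤ) (hp : 2 ≤ p) : Function.Injective (FreeGroup.lift (sanov p)) := by
  apply FreeGroup.injective_lift_of_ping_pong (sanov p) ppX ppY
  · intro i
    fin_cases i
    · exact ⟨1, by simp [ppX]⟩
    · refine ⟨⟨!![0, -1; 1, 0], by simp⟩, ?_⟩
      change |(0 : ℤ)| < |(1 : ℤ)| ∧ (0 : ℤ) ≤ 0 * 1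
      simp
  · intro i j hij
    rw [Function.onFun, Set.disjoint_left]
    intro g h1 h2
    fin_cases i <;> fin_cases j <;> simp [ppX] at hij h1 h2
    · exact absurd h1.1 (not_le.2 h2.1)
    · exact absurd h2.1 (not_le.2 h1.1)
  · intro i j hij
    rw [Function.onFun, Set.disjoint_left]
    intro g h1 h2
    fin_cases i <;> fin_cases j <;> simp [ppY] at hij h1 h2
    · exact absurd h2.1 (not_le.2 h1.1)
    · exact absurd h1.1 (not_le.2 h2.1)
  · intro i j
    rw [Set.disjoint_left]
    intro g h1 h2
    fin_cases i <;> fin_cases j <;> simp [ppX, ppY] at h1 h2 <;>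
      exact absurd h1.2 (not_le.2 h2.2)
  · intro i
    rintro _ ⟨g, hg, rfl⟩
    have h0 := sl2_col g
    fin_cases i
    · have := pp_aux1 (x := g 0 0) (y := g 1 0) hp hg
      change |(sanov p 0 * g) 1 0| ≤ |(sanov p 0 * g) 0 0| ∧ 0 ≤ (sanov p 0 * g) 0 0 * (sanov p 0 * g) 1 0
      rwa [(sanov0 p g).1, (sanov0 p g).2]
    · have := pp_aux3 (x := g 1 0) (y := g 0 0) hp (by tauto) (by
        rw [mul_comm]; exact hg)
      change |(sanov p 1 * g) 0 0| < |(sanov p 1 * g) 1 0| ∧ 0 ≤ (sanov p 1 * g) 0 0 * (sanov p 1 * g) 1 0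
      rwa [(sanov1 p g).1, (sanov1 p g).2, mul_comm (g 0 0)]
  · intro i
    rintro _ ⟨g, hg, rfl⟩
    have h0 := sl2_col g
    change (sanov p i)⁻¹ * g ∈ _
    rw [sanov_inv]
    fin_cases i
    · have := pp_aux2 (x := g 0 0) (y := g 1 0) hp hg
      change |(sanov (-p) 0 * g) 1 0| < |(sanov (-p) 0 * g) 0 0| ∧ (sanov (-p) 0 * g) 0 0 * (sanov (-p) 0 * g) 1 0 < 0
      rwa [(sanov0 _ g).1, (sanov0 _ g).2, neg_mul, ← sub_eq_add_neg]
    · have := pp_aux4 (x := g 1 0) (y := g 0 0) hp (by tauto) (by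
        rw [mul_comm]; exact hg)
      change |(sanov (-p) 1 * g) 0 0| ≤ |(sanov (-p) 1 * g) 1 0| ∧ (sanov (-p) 1 * g) 0 0 * (sanov (-p) 1 * g) 1 0 < 0
      rwa [(sanov1 _ g).1, (sanov1 _ g).2, neg_mul, ← sub_eq_add_neg, mul_comm (g 0 0)]

end pingpong
end FigEight

namespace FigEight

section filt
variable {A : Type} [Ring A] {J : Submodule ℤ A}

lemma jpow_left (hl : ∀ a, ∀ x ∈ J, a * x ∈ J) (i : ℕ) (a x : A) (hx : x ∈ J ^ (i + 1)) :
    a * x ∈ J ^ (i + 1) := by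
  rw [pow_succ'] at hx ⊢
  refine Submodule.mul_induction_on hx ?_ ?_
  · intro m hm n hn
    rw [← mul_assoc]
    exact Submodule.mul_mem_mul (hl a m hm) hn
  · intro x y hx hy
    rw [mul_add]; exact add_mem hx hy

lemma jpow_right (hr : ∀ a, ∀ x ∈ J, x * a ∈ J) (i : ℕ) (a x : A) (hx : x ∈ J ^ (i + 1)) :
    x * a ∈ J ^ (i + 1) := by
  rw [pow_succ] at hx ⊢
  refine Submodule.mul_induction_on hx ?_ ?_
  · intro m hm n hn
    rw [mul_assoc]
    exact Submodule.mul_mem_mul hm (hr a n hn)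
  · intro x y hx hy
    rw [add_mul]; exact add_mem hx hy

lemma jpow_mul {i j : ℕ} {x y : A} (hx : x ∈ J ^ i) (hy : y ∈ J ^ j) : x * y ∈ J ^ (i + j) := by
  rw [pow_add]; exact Submodule.mul_mem_mul hx hy

lemma jpow_le (hl : ∀ a, ∀ x ∈ J, a * x ∈ J) {i j : ℕ} (h : i ≤ j) :
    J ^ (j + 1) ≤ J ^ (i + 1) := by
  induction j, h using Nat.le_induction with
  | base => exact le_rfl
  | succ j hj ih =>
    refine le_trans ?_ ih
    intro x hx
    rw [pow_succ'] at hx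
    refine Submodule.mul_induction_on hx ?_ ?_
    · intro m hm n hn
      exact jpow_left hl _ _ _ hn
    · intro x y hx hy
      exact add_mem hx hy

lemma jpow_map (T : A →+* A) (hT : ∀ x ∈ J, T x ∈ J) (i : ℕ) (x : A) (hx : x ∈ J ^ (i + 1)) :
    T x ∈ J ^ (i + 1) := by
  induction i generalizing x with
  | zero => simpa using hT x (by simpa using hx)
  | succ i ih =>
    rw [pow_succ] at hx ⊢
    refine Submodule.mul_induction_on hx ?_ ?_
    · intro m hm n hn
      rw [map_mul]
      exact Submodule.mul_mem_mul (ih m hm) (hT n hn)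
    · intro x y hx hy
      rw [map_add]; exact add_mem hx hy

lemma jpow_diff (T : A →+* A) (hT : ∀ x ∈ J, T x ∈ J) (hE : ∀ x, T x - x ∈ J ^ 2) (i : ℕ) (x : A)
    (hx : x ∈ J ^ (i + 1)) : T x - x ∈ J ^ (i + 2) := by
  induction i generalizing x with
  | zero => exact hE x
  | succ i ih =>
    rw [pow_succ] at hx
    refine Submodule.mul_induction_on hx ?_ ?_
    · intro m hm n hn
      rw [map_mul]
      have h1 : (T m - m) * T n ∈ J ^ (i + 2 + 1) := by
        have := jpow_mul (ih m hm) (show T n ∈ J ^ 1 by simpa using hT n hn)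
        exact this
      have h2 : m * (T n - n) ∈ J ^ (i + 1 + 2) := jpow_mul hm (hE n)
      have : T m * T n - m * n = (T m - m) * T n + m * (T n - n) := by noncomm_ring
      rw [this]
      exact add_mem h1 h2
    · intro x y hx hy
      rw [map_add, add_sub_add_comm]; exact add_mem hx hy

end filt

section freegroup

abbrev F2 := FreeGroup (Fin 2)
abbrev A2 := MonoidAlgebra ℤ F2

noncomputable def br : F2 →* A2 := MonoidAlgebra.of ℤ F2

noncomputable def eps (p : ℕ) : A2 →ₐ[ℤ] ZMod p := MonoidAlgebra.lift ℤ (ZMod p) F2 1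

lemma eps_br (p : ℕ) (u : F2) : eps p (br u) = 1 := by simp [eps, br]

noncomputable def JJ (p : ℕ) : Submodule ℤ A2 := LinearMap.ker (eps p).toLinearMap

lemma mem_JJ {p : ℕ} {x : A2} : x ∈ JJ p ↔ eps p x = 0 := Iff.rfl

lemma JJ_left (p : ℕ) : ∀ a, ∀ x ∈ JJ p, a * x ∈ JJ p := by
  intro a x hx; rw [mem_JJ] at *; rw [map_mul, hx, mul_zero]
lemma JJ_right (p : ℕ) : ∀ a, ∀ x ∈ JJ p, x * a ∈ JJ p := by
  intro a x hx; rw [mem_JJ] at *; rw [map_mul, hx, zero_mul]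

lemma br_sub_one (p : ℕ) (u : F2) : br u - 1 ∈ JJ p := by
  rw [mem_JJ, map_sub, eps_br, map_one, sub_self]

lemma p_mem (p : ℕ) : (p : A2) ∈ JJ p := by
  rw [mem_JJ, map_natCast, CharP.cast_eq_zero]

lemma A2_hom_ext {R : Type} [Ring R] {f g : A2 →+* R} (h : ∀ u, f (br u) = g (br u)) : f = g := by
  apply MonoidAlgebra.ringHom_ext'
  · exact RingHom.ext_int _ _
  · ext u
    exact h _

/-- induced map -/
noncomputable def hat (θ : MulAut F2) : A2 →+* A2 :=
  (MonoidAlgebra.lift ℤ A2 F2 (br.comp θ.toMonoidHom)).toRingHom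

lemma hat_br (θ : MulAut F2) (u : F2) : hat θ (br u) = br (θ u) := by
  change MonoidAlgebra.lift ℤ A2 F2 (br.comp θ.toMonoidHom) (MonoidAlgebra.of ℤ F2 u) = _
  rw [MonoidAlgebra.lift_of]; rfl

lemma hat_JJ (p : ℕ) (θ : MulAut F2) : ∀ x ∈ JJ p, hat θ x ∈ JJ p := by
  intro x hx
  have : (eps p).toRingHom.comp (hat θ) = (eps p).toRingHom := by
    apply A2_hom_ext
    intro u
    rw [RingHom.comp_apply, hat_br]
    exact (eps_br p _).trans (eps_br p _).symm
  have h2 := DFunLike.congr_fun this x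
  rw [mem_JJ] at *
  rw [← hx]; exact h2

/-- automorphisms acting trivially modulo `J ^ 2` -/
noncomputable def EE (p : ℕ) : Subgroup (MulAut F2) where
  carrier := {θ | ∀ v, br (θ v) - br v ∈ JJ p ^ 2}
  one_mem' := by intro v; simp
  mul_mem' := by
    intro θ η h1 h2 v
    have := add_mem (h1 (η v)) (h2 v)
    simpa using this
  inv_mem' := by
    intro θ h v
    have := neg_mem (h (θ⁻¹ v))
    simpa using this

lemma EE_all {p : ℕ} {θ : MulAut F2} (h : θ ∈ EE p) (x : A2) : hat θ x - x ∈ JJ p ^ 2 := by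
  induction x using MonoidAlgebra.induction_linear with
  | zero => simp
  | add f g hf hg => rw [map_add, add_sub_add_comm]; exact add_mem hf hg
  | single u n =>
    have : (MonoidAlgebra.single u n : A2) = n • br u := by simp [br]
    rw [this, map_zsmul, hat_br, ← smul_sub]
    exact Submodule.smul_mem _ _ (h u)

lemma EE_conj (p : ℕ) (v : F2) : MulAut.conj v ∈ EE p := by
  intro w
  rw [MulAut.conj_apply]
  have h1 : br v * br v⁻¹ = 1 := by rw [← map_mul]; simp
  have : br (v * w * v⁻¹) - br w =
      ((br v - 1) * (br w - 1) - (br w - 1) * (br v - 1)) * br v⁻¹ := by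
    have e : (br v - 1) * (br w - 1) - (br w - 1) * (br v - 1) = br v * br w - br w * br v := by
      noncomm_ring
    rw [e, sub_mul, mul_assoc (br w), h1]
    simp
  rw [this]
  apply jpow_right (JJ_right p)
  rw [show (1 + 1) = 2 from rfl, pow_two]
  exact sub_mem (Submodule.mul_mem_mul (br_sub_one p v) (br_sub_one p w))
    (Submodule.mul_mem_mul (br_sub_one p w) (br_sub_one p v))

/-- the twisted product -/
def tw (θ : MulAut F2) (u : F2) : ℕ → F2
  | 0 => 1
  | n + 1 => u * θ (tw θ u n)

lemma tw_step {p : ℕ} {θ : MulAut F2} (h : θ ∈ EE p) (u : F2) (i : ℕ) (hu : br u - 1 ∈ JJ p ^ (i + 1))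
    (n : ℕ) : br (tw θ u n) - 1 - n • (br u - 1) ∈ JJ p ^ (i + 2) := by
  induction n with
  | zero => simp [tw]
  | succ n ih =>
    set α := br u - 1 with hα
    set β := br (tw θ u n) - 1 with hβ
    have hβi : β ∈ JJ p ^ (i + 1) := by
      have h1 := jpow_le (JJ_left p) (Nat.le_succ i) ih
      have h2 : n • α ∈ JJ p ^ (i + 1) := Submodule.smul_of_tower_mem _ n hu
      simpa using add_mem h1 h2
    have h3 := jpow_diff (hat θ) (hat_JJ p θ) (EE_all h) i β hβi
    have h4 : α * hat θ β ∈ JJ p ^ (i + 2) := by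
      have := jpow_mul hu (jpow_map (hat θ) (hat_JJ p θ) i β hβi)
      exact jpow_le (JJ_left p) (show i + 1 ≤ i + 1 + i by omega) this
    have h5 : br (tw θ u (n + 1)) = (1 + α) * (1 + hat θ β) := by
      rw [tw, map_mul, ← hat_br]
      congr 1
      · rw [hα]; abel
      · rw [hβ, map_sub, map_one]; abel
    have : br (tw θ u (n + 1)) - 1 - (n + 1) • α = (hat θ β - β) + (β - n • α) + α * hat θ β := by
      rw [h5, add_smul, one_smul]; noncomm_ring
    rw [this]
    exact add_mem (add_mem h3 ih) h4

lemma tw_one_mem {p q : ℕ} (hpq : p.Coprime q) {θ : MulAut F2} (h : θ ∈ EE p) (u : F2)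
    (h1 : tw θ u q = 1) (i : ℕ) : br u - 1 ∈ JJ p ^ (i + 1) := by
  induction i with
  | zero => simpa using br_sub_one p u
  | succ i ih =>
    have h2 := tw_step h u i ih q
    rw [h1, map_one, sub_self, zero_sub, neg_mem_iff] at h2
    have h3 : (p : A2) * (br u - 1) ∈ JJ p ^ (i + 2) := by
      have := jpow_mul (show (p : A2) ∈ JJ p ^ 1 by simpa using p_mem p) ih
      rwa [show 1 + (i + 1) = i + 2 by omega] at this
    have h4 := Nat.gcd_eq_gcd_ab p q
    rw [hpq.gcd_eq_one] at h4
    have h5 : br u - 1 = (Nat.gcdA p q) • ((p : A2) * (br u - 1)) +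
        (Nat.gcdB p q) • (q • (br u - 1)) := by
      have : br u - 1 = ((1 : ℕ) : ℤ) • (br u - 1) := by simp
      conv_lhs => rw [this, h4]
      rw [add_smul, mul_comm (p : ℤ), mul_comm (q : ℤ), mul_smul, mul_smul, natCast_zsmul,
        natCast_zsmul, nsmul_eq_mul]
    rw [h5]
    exact add_mem (Submodule.smul_mem _ _ h3) (Submodule.smul_mem _ _ h2)

noncomputable def rhoSL (p : ℕ) : F2 →* Matrix.SpecialLinearGroup (Fin 2) ℤ :=
  FreeGroup.lift (sanov p)

noncomputable def rhoM (p : ℕ) : F2 →* Matrix (Fin 2) (Fin 2) ℤ :=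
  { toFun := fun u => (rhoSL p u).1
    map_one' := by rw [map_one]; rfl
    map_mul' := fun x y => by rw [map_mul]; rfl }

noncomputable def rhoA (p : ℕ) : A2 →+* Matrix (Fin 2) (Fin 2) ℤ :=
  (MonoidAlgebra.lift ℤ (Matrix (Fin 2) (Fin 2) ℤ) F2 (rhoM p)).toRingHom

lemma rhoA_br (p : ℕ) (u : F2) : rhoA p (br u) = (rhoSL p u).1 := by
  change MonoidAlgebra.lift ℤ (Matrix (Fin 2) (Fin 2) ℤ) F2 (rhoM p) (MonoidAlgebra.of ℤ F2 u) = _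
  rw [MonoidAlgebra.lift_of]; rfl

lemma rhoSL_mod (p : ℕ) (u : F2) :
    (Int.castRingHom (ZMod p)).mapMatrix (rhoSL p u).1 = 1 := by
  let f : F2 →* Matrix (Fin 2) (Fin 2) (ZMod p) :=
    (Int.castRingHom (ZMod p)).mapMatrix.toMonoidHom.comp (rhoM p)
  have : f = 1 := by
    ext i : 1
    change (Int.castRingHom (ZMod p)).mapMatrix (rhoSL p (FreeGroup.of i)).1 = 1
    rw [rhoSL, FreeGroup.lift_apply_of]
    fin_cases i <;> (ext j k; fin_cases j <;> fin_cases k <;> simp [sanov])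
  exact DFunLike.congr_fun this u

lemma rhoA_JJ (p : ℕ) (x : A2) (hx : x ∈ JJ p) (i j : Fin 2) : (p : ℤ) ∣ rhoA p x i j := by
  have : ((Int.castRingHom (ZMod p)).mapMatrix).comp (rhoA p) =
      (algebraMap (ZMod p) (Matrix (Fin 2) (Fin 2) (ZMod p))).comp (eps p).toRingHom := by
    apply A2_hom_ext
    intro u
    rw [RingHom.comp_apply, rhoA_br, rhoSL_mod, RingHom.comp_apply]
    have : (eps p).toRingHom (br u) = 1 := eps_br p u
    rw [this, map_one]
  have h2 := DFunLike.congr_fun this x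
  have h3 : (eps p).toRingHom x = 0 := hx
  rw [RingHom.comp_apply, RingHom.comp_apply, h3, map_zero] at h2
  have h4 := congrFun (congrFun h2 i) j
  exact (ZMod.intCast_zmod_eq_zero_iff_dvd _ _).1 h4

lemma rhoA_pow (p : ℕ) (n : ℕ) (x : A2) (hx : x ∈ JJ p ^ (n + 1)) (i j : Fin 2) :
    (p : ℤ) ^ (n + 1) ∣ rhoA p x i j := by
  induction n generalizing x i j with
  | zero => simpa using rhoA_JJ p x (by simpa using hx) i j
  | succ n ih =>
    rw [pow_succ] at hx
    refine Submodule.mul_induction_on hx ?_ ?_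
    · intro y hy z hz
      rw [map_mul, Matrix.mul_apply]
      refine Finset.dvd_sum fun k _ => ?_
      rw [pow_succ]
      exact mul_dvd_mul (ih y hy i k) (rhoA_JJ p z hz k j)
    · intro y z hy hz
      rw [map_add, Matrix.add_apply]
      exact dvd_add hy hz

lemma sep_J {p : ℕ} (hp : 2 ≤ p) (u : F2) (h : ∀ i, br u - 1 ∈ JJ p ^ (i + 1)) : u = 1 := by
  apply sanov_injective p (by exact_mod_cast hp)
  change rhoSL p u = FreeGroup.lift _ 1
  rw [map_one]
  apply Subtype.ext
  have h0 : rhoA p (br u - 1) = 0 := by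
    ext i j
    by_contra hne
    have hd := fun n => rhoA_pow p n _ (h n) i j
    have := (Int.finiteMultiplicity_iff.2 ⟨by
      rw [Int.natAbs_natCast]; omega, hne⟩ : FiniteMultiplicity (p : ℤ) (rhoA p (br u - 1) i j))
    obtain ⟨n, hn⟩ := this
    exact hn (hd n)
  rw [map_sub, map_one, sub_eq_zero, rhoA_br] at h0
  exact h0

theorem tw_eq_one {p q : ℕ} (hp : 2 ≤ p) (hpq : p.Coprime q) {θ : MulAut F2} (h : θ ∈ EE p) (u : F2)
    (h1 : tw θ u q = 1) : u = 1 :=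
  sep_J hp u (tw_one_mem hpq h u h1)

end freegroup
end FigEight

namespace FigEight

noncomputable def phiFh : F2 →* F2 :=
  FreeGroup.lift ![FreeGroup.of 0 * FreeGroup.of 1 * FreeGroup.of 0, FreeGroup.of 1 * FreeGroup.of 0]
noncomputable def phiFi : F2 →* F2 :=
  FreeGroup.lift ![FreeGroup.of 0 * (FreeGroup.of 1)⁻¹,
    FreeGroup.of 1 * FreeGroup.of 1 * (FreeGroup.of 0)⁻¹]

noncomputable def phiF : MulAut F2 := MonoidHom.toMulEquiv phiFh phiFi
  (by ext i : 1; fin_cases i <;> simp [phiFh, phiFi]; group)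
  (by ext i : 1; fin_cases i <;> simp [phiFh, phiFi]; group)

lemma phiF_a : phiF (FreeGroup.of 0) = FreeGroup.of 0 * FreeGroup.of 1 * FreeGroup.of 0 := by
  rw [phiF, MonoidHom.toMulEquiv_apply]
  simp [phiFh]
lemma phiF_b : phiF (FreeGroup.of 1) = FreeGroup.of 1 * FreeGroup.of 0 := by
  rw [phiF, MonoidHom.toMulEquiv_apply]
  simp [phiFh]

lemma phiF_pow_a (n : ℕ) : (phiF ^ (n + 1)) (FreeGroup.of 0) =
    (phiF ^ n) (FreeGroup.of 0) * (phiF ^ n) (FreeGroup.of 1) * (phiF ^ n) (FreeGroup.of 0) := by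
  rw [pow_succ, MulAut.mul_apply, phiF_a, map_mul, map_mul]
lemma phiF_pow_b (n : ℕ) : (phiF ^ (n + 1)) (FreeGroup.of 1) =
    (phiF ^ n) (FreeGroup.of 1) * (phiF ^ n) (FreeGroup.of 0) := by
  rw [pow_succ, MulAut.mul_apply, phiF_b, map_mul]

/-- the abelianised map -/
noncomputable def eHom (p : ℕ) : F2 →* Multiplicative (A2 ⧸ (JJ p ^ 2)) where
  toFun u := Multiplicative.ofAdd (Submodule.Quotient.mk (br u - 1))
  map_one' := by simp
  map_mul' u v := by
    rw [← ofAdd_add, ← Submodule.Quotient.mk_add]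
    congr 1
    rw [Submodule.Quotient.eq]
    have : br (u * v) - 1 - (br u - 1 + (br v - 1)) = (br u - 1) * (br v - 1) := by
      rw [map_mul]; noncomm_ring
    rw [this, pow_two]
    exact Submodule.mul_mem_mul (br_sub_one p u) (br_sub_one p v)

lemma eHom_pow (p : ℕ) (u : F2) : (eHom p u) ^ p = 1 := by
  change Multiplicative.ofAdd (p • (Submodule.Quotient.mk (br u - 1) : A2 ⧸ (JJ p ^ 2))) = 1
  rw [← Submodule.Quotient.mk_smul, ofAdd_eq_one, Submodule.Quotient.mk_eq_zero, nsmul_eq_mul, pow_two]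
  exact Submodule.mul_mem_mul (p_mem p) (br_sub_one p u)

lemma EE_of_eHom {p : ℕ} {θ : MulAut F2} (h : ∀ i, eHom p (θ (FreeGroup.of i)) = eHom p (FreeGroup.of i)) :
    θ ∈ EE p := by
  intro v
  have : (eHom p).comp θ.toMonoidHom = eHom p := by
    ext i : 1
    exact h i
  have h2 := DFunLike.congr_fun this v
  have h3 : (Submodule.Quotient.mk (br (θ v) - 1) : A2 ⧸ (JJ p ^ 2)) = Submodule.Quotient.mk (br v - 1) := h2
  rw [Submodule.Quotient.eq] at h3
  simpa using h3

lemma ab_rec {C : Type} [CommGroup C] (e : F2 →* C) (n : ℕ) (k l m : ℕ)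
    (h1 : e ((phiF ^ n) (FreeGroup.of 0)) = e (FreeGroup.of 0) ^ k * e (FreeGroup.of 1) ^ l)
    (h2 : e ((phiF ^ n) (FreeGroup.of 1)) = e (FreeGroup.of 0) ^ l * e (FreeGroup.of 1) ^ m) :
    e ((phiF ^ (n + 1)) (FreeGroup.of 0)) =
      e (FreeGroup.of 0) ^ (2 * k + l) * e (FreeGroup.of 1) ^ (2 * l + m) ∧
    e ((phiF ^ (n + 1)) (FreeGroup.of 1)) =
      e (FreeGroup.of 0) ^ (k + l) * e (FreeGroup.of 1) ^ (l + m) := by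
  rw [phiF_pow_a, phiF_pow_b]
  simp only [map_mul, h1, h2, two_mul, pow_add]
  generalize e (FreeGroup.of 0) ^ k = A
  generalize e (FreeGroup.of 0) ^ l = B
  generalize e (FreeGroup.of 1) ^ l = C'
  generalize e (FreeGroup.of 1) ^ m = D
  constructor
  · simp only [mul_comm, mul_left_comm]
  · simp only [mul_comm, mul_left_comm]

lemma phi3_mem : phiF ^ 3 ∈ EE 2 := by
  apply EE_of_eHom
  have ha := eHom_pow 2 (FreeGroup.of 0)
  have hb := eHom_pow 2 (FreeGroup.of 1)
  obtain ⟨h1, g1⟩ := ab_rec (eHom 2) 0 1 0 1 (by simp) (by simp)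
  obtain ⟨h2, g2⟩ := ab_rec (eHom 2) 1 2 1 1 h1 g1
  obtain ⟨h3, g3⟩ := ab_rec (eHom 2) 2 5 3 2 h2 g2
  norm_num at h3 g3
  intro i
  fin_cases i
  · simp only [Fin.zero_eta]
    rw [h3, show 13 = 2 * 6 + 1 from rfl, show 8 = 2 * 4 from rfl, pow_add, pow_mul, pow_mul, ha, hb]
    simp
  · simp only [Fin.mk_one]
    rw [g3, show 8 = 2 * 4 from rfl, show 5 = 2 * 2 + 1 from rfl, pow_add, pow_mul, pow_mul, ha, hb]
    simp

lemma phi5_mem : phiF ^ 5 ∈ EE 11 := by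
  apply EE_of_eHom
  have ha := eHom_pow 11 (FreeGroup.of 0)
  have hb := eHom_pow 11 (FreeGroup.of 1)
  obtain ⟨h1, g1⟩ := ab_rec (eHom 11) 0 1 0 1 (by simp) (by simp)
  obtain ⟨h2, g2⟩ := ab_rec (eHom 11) 1 2 1 1 h1 g1
  obtain ⟨h3, g3⟩ := ab_rec (eHom 11) 2 5 3 2 h2 g2
  obtain ⟨h4, g4⟩ := ab_rec (eHom 11) 3 13 8 5 h3 g3
  obtain ⟨h5, g5⟩ := ab_rec (eHom 11) 4 34 21 13 h4 g4
  norm_num at h5 g5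
  intro i
  fin_cases i
  · simp only [Fin.zero_eta]
    rw [h5, show 89 = 11 * 8 + 1 from rfl, show 55 = 11 * 5 from rfl, pow_add, pow_mul, pow_mul, ha, hb]
    simp
  · simp only [Fin.mk_one]
    rw [g5, show 55 = 11 * 5 from rfl, show 34 = 11 * 3 + 1 from rfl, pow_add, pow_mul, pow_mul, ha, hb]
    simp

abbrev Gam := F2 ⋊[zpowersHom (MulAut F2) phiF] Multiplicative ℤ

open SemidirectProduct in
lemma gam_conj (X : Gam) (u : F2) :
    X * inl u * X⁻¹ = inl ((MulAut.conj X.left * phiF ^ (Multiplicative.toAdd X.right)) u) := by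
  ext
  · simp [mul_assoc]
  · simp

open SemidirectProduct in
lemma gam_pow (X : Gam) (θ : MulAut F2) (hθ : ∀ u, X * inl u * X⁻¹ = inl (θ u)) (u : F2) (n : ℕ) :
    (inl u * X) ^ n = inl (tw θ u n) * X ^ n := by
  induction n with
  | zero => simp [tw]
  | succ n ih =>
    rw [pow_succ', ih, tw, map_mul, ← hθ, pow_succ']
    group

open SemidirectProduct in
lemma gam_roots_aux {p q r : ℕ} (hp : 2 ≤ p) (hpq : p.Coprime q) (hr : phiF ^ r ∈ EE p)
    (x y : Gam) (hxy : x.right = y.right) (h : x ^ q = y ^ q) : x ^ r = y ^ r := by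
  set X := x ^ r with hX
  set Y := y ^ r with hY
  have hR : X.right = Y.right := by
    have h1 : rightHom X = rightHom Y := by
      rw [hX, hY, map_pow, map_pow]; exact congrArg (· ^ r) hxy
    exact h1
  have hq : X ^ q = Y ^ q := by rw [hX, hY, ← pow_mul, ← pow_mul, mul_comm, pow_mul, pow_mul, h]
  have hker : Y * X⁻¹ ∈ (rightHom : Gam →* _).ker := by
    rw [MonoidHom.mem_ker, map_mul, map_inv, mul_inv_eq_one]; exact hR.symm
  rw [← range_inl_eq_ker_rightHom] at hker
  obtain ⟨u, hu⟩ := hker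
  have hYu : Y = inl u * X := by rw [hu]; group
  set θ := MulAut.conj X.left * phiF ^ (Multiplicative.toAdd X.right) with hθ
  have hE : θ ∈ EE p := by
    apply mul_mem (EE_conj p _)
    have h2 : X.right = x.right ^ r := by
      change rightHom X = (rightHom x) ^ r
      rw [hX, map_pow]
    rw [h2, toAdd_pow, nsmul_eq_mul, zpow_mul, zpow_natCast]
    exact zpow_mem hr _
  have h3 := gam_pow X θ (gam_conj X) u q
  rw [← hYu, ← hq] at h3
  have h4 : (inl (tw θ u q) : Gam) = 1 := by
    exact (mul_eq_right.1 h3.symm)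
  have h5 : tw θ u q = 1 := inl_injective (h4.trans (map_one inl).symm)
  have h6 := tw_eq_one hp hpq hE u h5
  rw [hYu, h6, map_one, one_mul]

lemma eq_of_coprime_pow {G : Type} [Group G] {x y : G} {m n : ℕ} (h : m.Coprime n)
    (h1 : x ^ m = y ^ m) (h2 : x ^ n = y ^ n) : x = y := by
  have h4 := Nat.gcd_eq_gcd_ab m n
  rw [h.gcd_eq_one] at h4
  have key : ∀ z : G, z = (z ^ m) ^ (m.gcdA n) * (z ^ n) ^ (m.gcdB n) := by
    intro z
    rw [← zpow_natCast, ← zpow_natCast, ← zpow_mul, ← zpow_mul, ← zpow_add, ← h4]; simp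
  rw [key x, key y, h1, h2]

lemma gam_roots_prime {q : ℕ} (hq : q.Prime) (x y : Gam) (h : x ^ q = y ^ q) : x = y := by
  have hxy : x.right = y.right := by
    have h1 : (SemidirectProduct.rightHom x) ^ q = (SemidirectProduct.rightHom y) ^ q := by
      rw [← map_pow, ← map_pow, h]
    have h2 := congrArg Multiplicative.toAdd h1
    rw [toAdd_pow, toAdd_pow, nsmul_eq_mul, nsmul_eq_mul] at h2
    have h3 := mul_left_cancel₀ (by exact_mod_cast hq.ne_zero) h2
    exact Multiplicative.toAdd.injective h3
  by_cases h23 : q = 2 ∨ q = 3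
  · have h1 : x ^ 5 = y ^ 5 := gam_roots_aux (p := 11) (q := q) (by norm_num)
      (by rcases h23 with rfl | rfl <;> decide) phi5_mem x y hxy h
    refine eq_of_coprime_pow (m := q) (n := 5) ?_ h h1
    rcases h23 with rfl | rfl <;> decide
  · have h1 : x ^ 3 = y ^ 3 := gam_roots_aux (p := 2) (q := q) (by norm_num)
      ((Nat.coprime_primes Nat.prime_two hq).2 (by tauto)) phi3_mem x y hxy h
    refine eq_of_coprime_pow (m := q) (n := 3) ?_ h h1
    exact (Nat.coprime_primes hq Nat.prime_three).2 (by tauto)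

lemma gam_roots {m : ℕ} (hm : m ≠ 0) : ∀ x y : Gam, x ^ m = y ^ m → x = y := by
  induction m using Nat.recOnMul with
  | zero => exact absurd rfl hm
  | one => simp
  | prime q hq => exact gam_roots_prime hq
  | mul a b ha hb =>
    intro x y h
    rw [pow_mul, pow_mul] at h
    exact ha (left_ne_zero_of_mul hm) _ _ (hb (right_ne_zero_of_mul hm) _ _ h)

open SemidirectProduct in
noncomputable def toGam : G8 →* Gam :=
  g8Lift ![inl (FreeGroup.of 0), inl (FreeGroup.of 1), inr (Multiplicative.ofAdd 1)]
    (by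
      ext
      · simp [phiF_a]
      · simp)
    (by
      ext
      · simp [phiF_b]
      · simp)

noncomputable def fromF : F2 →* G8 := FreeGroup.lift ![ga, gb]

lemma fromF_phi (w : F2) : fromF (phiF w) = gt * fromF w * gt⁻¹ := by
  have : fromF.comp phiF.toMonoidHom = (MulAut.conj gt).toMonoidHom.comp fromF := by
    ext i : 1
    fin_cases i
    · change fromF (phiF (FreeGroup.of 0)) = gt * fromF (FreeGroup.of 0) * gt⁻¹
      rw [phiF_a]
      simp [fromF, g_rel1]
    · change fromF (phiF (FreeGroup.of 1)) = gt * fromF (FreeGroup.of 1) * gt⁻¹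
      rw [phiF_b]
      simp [fromF, g_rel2]
  exact DFunLike.congr_fun this w

lemma fromF_zpow (n : ℤ) : ∀ w : F2, fromF ((phiF ^ n) w) = gt ^ n * fromF w * (gt ^ n)⁻¹ := by
  induction n with
  | zero => simp
  | succ n ih =>
    intro w
    rw [zpow_add, zpow_one, MulAut.mul_apply, ih, fromF_phi, zpow_add]
    group
  | pred n ih =>
    intro w
    obtain ⟨v, rfl⟩ := phiF.surjective w
    rw [zpow_sub, zpow_one, MulAut.mul_apply, MulAut.inv_apply_self, ih, fromF_phi, zpow_sub]
    group

noncomputable def fromGam : Gam →* G8 :=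
  SemidirectProduct.lift fromF (zpowersHom G8 gt) (by
    intro n
    ext i : 1
    exact fromF_zpow _ _)

lemma fromGam_toGam (g : G8) : fromGam (toGam g) = g := by
  have : fromGam.comp toGam = MonoidHom.id G8 := by
    apply PresentedGroup.ext
    intro x
    change fromGam (toGam (PresentedGroup.of x)) = PresentedGroup.of x
    rw [toGam, g8Lift_of]
    fin_cases x <;> simp [fromGam, fromF, ga, gb, gt]
  exact DFunLike.congr_fun this g

theorem g8_roots {m : ℕ} (hm : m ≠ 0) (x y : G8) (h : x ^ m = y ^ m) : x = y := by
  rw [← fromGam_toGam x, ← fromGam_toGam y,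
    gam_roots hm (toGam x) (toGam y) (by rw [← map_pow, ← map_pow, h])]

end FigEight

namespace FigEight

lemma finiteIndex_ker_map {G K : Type} [Group G] [Group K] [Finite K] (N : Subgroup G)
    [N.FiniteIndex] (c : N →* K) : (c.ker.map N.subtype).FiniteIndex := by
  refine ⟨?_⟩
  rw [Subgroup.index_map_subtype]
  exact mul_ne_zero (Subgroup.FiniteIndex.index_ne_zero (H := c.ker))
    (Subgroup.FiniteIndex.index_ne_zero (H := N))

theorem assemble {G : Type} [Group G] (N : Subgroup G) [N.Normal] [N.FiniteIndex]
    {H : Type} [Group H] (i : N →* H) (j : H →* G) (hij : ∀ n, j (i n) = n)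
    (sep : ∀ x y : H, ∃ (K : Type) (_ : Group K) (_ : Finite K) (c : H →* K),
      IsConj (c x) (c y) → IsConj x y)
    (roots : ∀ m : ℕ, m ≠ 0 → ∀ x y : G, x ^ m = y ^ m → x = y) : ConjSeparable G := by
  intro x y hxy
  have hm : N.index ≠ 0 := Subgroup.FiniteIndex.index_ne_zero
  let x' : G ⧸ N → N := fun q => ⟨(q.out * x * q.out⁻¹) ^ N.index, N.pow_index_mem _⟩
  let y' : N := ⟨y ^ N.index, N.pow_index_mem _⟩
  choose K hK1 hK2 c hc using fun q => sep (i (x' q)) (i y')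
  let L : G ⧸ N → Subgroup G := fun q => (((c q).comp i).ker).map N.subtype
  have hL : ∀ q, (L q).FiniteIndex := fun q => finiteIndex_ker_map N _
  have hL2 : (⨅ q, L q).FiniteIndex := Subgroup.finiteIndex_iInf hL
  refine ⟨G ⧸ (⨅ q, L q).normalCore, inferInstance, inferInstance, QuotientGroup.mk' _, ?_⟩
  intro hcon
  apply hxy
  rw [isConj_iff] at hcon
  obtain ⟨g, hg⟩ := hcon
  obtain ⟨g, rfl⟩ := QuotientGroup.mk'_surjective _ g
  rw [← map_mul, ← map_inv, ← map_mul] at hg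
  have hg2 := congrArg (· ^ N.index) hg
  simp only [← map_pow] at hg2
  rw [QuotientGroup.mk'_eq_mk'] at hg2
  obtain ⟨k, hk, hgk⟩ := hg2
  let q : G ⧸ N := QuotientGroup.mk g
  have hn : g * q.out⁻¹ ∈ N := by
    have h1 : (q.out : G ⧸ N) = (g : G ⧸ N) := QuotientGroup.out_eq' q
    have h2 := QuotientGroup.eq.1 h1
    exact (inferInstance : N.Normal).mem_comm h2
  have hkL : k ∈ L q := (iInf_le L q) (Subgroup.normalCore_le _ hk)
  obtain ⟨k', hk', rfl⟩ := hkL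
  have hk1 : c q (i k') = 1 := hk'
  have hy : y' = ⟨_, hn⟩ * x' q * (⟨_, hn⟩ : N)⁻¹ * k' := by
    apply Subtype.ext
    change y ^ N.index = g * q.out⁻¹ * (q.out * x * q.out⁻¹) ^ N.index * (g * q.out⁻¹)⁻¹ * k'
    rw [← conj_pow, ← hgk]
    change _ * (k' : G) = _
    congr 2
    group
  have hcc : IsConj (c q (i (x' q))) (c q (i y')) := by
    rw [isConj_iff]
    refine ⟨c q (i ⟨_, hn⟩), ?_⟩
    rw [hy]
    simp only [map_mul, map_inv, hk1, mul_one]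
  have h3 := isConj_iff.1 (hc q hcc)
  obtain ⟨h, hh⟩ := h3
  have h4 := congrArg j hh
  rw [map_mul, map_mul, map_inv, hij, hij] at h4
  change j h * (q.out * x * q.out⁻¹) ^ N.index * (j h)⁻¹ = y ^ N.index at h4
  rw [← conj_pow] at h4
  have h5 := roots _ hm _ _ h4
  rw [isConj_iff]
  refine ⟨j h * q.out, ?_⟩
  rw [← h5]
  group

lemma comap_finiteIndex {G K : Type} [Group G] [Group K] (f : G →* K) (H0 : Subgroup K)
    [H0.FiniteIndex] : (H0.comap f).FiniteIndex := by
  refine ⟨?_⟩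
  rw [Subgroup.index_comap]
  exact Subgroup.FiniteIndex.index_ne_zero (H := H0.subgroupOf f.range)

def stabM {G S K : Type} [Group G] [Group K] (Φ : G →* Mono S K) (s : S) : Subgroup G :=
  (MulAction.stabilizer (Equiv.Perm S) s).comap ((Mono.permHom S K).comp Φ)

lemma mem_stabM {G S K : Type} [Group G] [Group K] (Φ : G →* Mono S K) (s : S) (g : G) :
    g ∈ stabM Φ s ↔ (Φ g).perm s = s := Iff.rfl

instance {G S K : Type} [Finite S] [Group G] [Group K] (Φ : G →* Mono S K) (s : S) :
    (stabM Φ s).FiniteIndex := comap_finiteIndex _ _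

theorem main8 : ConjSeparable G8 := by
  let H0 : Subgroup W8 := (stabM psiHom 0).normalCore
  have hH0 : H0.FiniteIndex := inferInstance
  let H : Subgroup W8 := stabSub H0
  have hHn : H.Normal := stabSub_normal H0
  have hHf : H.FiniteIndex := stabSub_finiteIndex H0
  have hH : ∀ h ∈ H, (psiHom h).perm 0 = 0 := fun h hh =>
    (mem_stabM _ _ _).1 (Subgroup.normalCore_le _ (stabSub_le H0 hh))
  let i0 : stabM phiHom 0 →* W8 := Mono.stabHom phiHom 0 (stabM phiHom 0) (fun h hh => hh)
  let N0 : Subgroup G8 := (H.comap i0).map (stabM phiHom 0).subtype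
  have hN0 : N0.FiniteIndex := by
    refine ⟨?_⟩
    rw [Subgroup.index_map_subtype]
    exact mul_ne_zero (comap_finiteIndex i0 H).index_ne_zero
      (Subgroup.FiniteIndex.index_ne_zero (H := stabM phiHom 0))
  let N : Subgroup G8 := N0.normalCore
  have hN1 : ∀ n ∈ N, (phiHom n).perm 0 = 0 ∧ (phiHom n).lab 0 ∈ H := by
    intro n hn
    obtain ⟨s, hs, rfl⟩ := Subgroup.normalCore_le _ hn
    exact ⟨s.2, hs⟩
  let iN : N →* W8 := Mono.stabHom phiHom 0 N (fun n hn => (hN1 n hn).1)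
  let i : N →* H := iN.codRestrict H (fun n => (hN1 n n.2).2)
  let j : H →* G8 := Mono.stabHom psiHom 0 H hH
  refine assemble N i j ?_ ?_ (fun m hm => g8_roots hm)
  · intro n
    have h1 := (psi_phi (n : G8) 0).2
    rw [(hN1 n n.2).1] at h1
    have h2 : gprod (usW 0) = 1 := rfl
    rw [h2, mul_one, one_mul] at h1
    exact h1
  · intro x y
    obtain ⟨K, hK1, hK2, c, hc⟩ := racg_sep adjP_symm H (fun S w hw => stabSub_rho H0 S hw) x y
    refine ⟨K, hK1, hK2, c, fun hcon => ?_⟩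
    obtain ⟨h, hh, he⟩ := hc hcon
    exact isConj_iff.2 ⟨⟨h, hh⟩, Subtype.ext he⟩

end FigEight

/-- the figure-eight knot group is conjugacy separable. -/
theorem figureEightKnotGroup_conjSeparable :
    ConjSeparable FigureEightKnotGroup := by
  exact FigEight.main8
end
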